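/- arXiv:2412.03207 — 3 statements merged into one kernel-verified Lean document; each statement's English description precedes it below -/
import Mathlib

section
/- Let G ∼ G(n,p) be the Erdős–Rényi undirected random graph with condescendence parameters α_i and initial opinions x(0) ∈ [0,1]^n. Suppose the Assumption holds (there exists ᾱ ∈ (0,1) such that for all n and every i ∈ [n], α_i ≤ ᾱ) and that p ≫ log(n)/n. Then ‖E(x(G,∞)) − x̄(∞)‖_∞ → 0 as n → ∞, where x(G,∞) is the stable opinion of the opinion dynamics on G and x̄(∞) is the stable solution of the mean-field dynamics. -/
open Finset Filter Topology Matrix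

attribute [local instance] Classical.propDecidable

noncomputable section

/-- The set of possible edges of a simple undirected graph on `Fin n`:
all unordered pairs of distinct nodes. A graph `G ∈ 𝔾ₙ` is identified with its
edge set, a subset of `allEdges n`. -/
def allEdges (n : ℕ) : Finset (Sym2 (Fin n)) :=
  Finset.univ.filter fun e => ¬ e.IsDiag

/-- Probability weight of a given edge set in the Erdős–Rényi model `G(n,p)`. -/
def erProb (n : ℕ) (p : ℝ) (E : Finset (Sym2 (Fin n))) : ℝ :=
  p ^ E.card * (1 - p) ^ ((allEdges n).card - E.card)

/-- Expectation of a real random variable in the Erdős–Rényi model `G(n,p)`. -/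
def erExp (n : ℕ) (p : ℝ) (X : Finset (Sym2 (Fin n)) → ℝ) : ℝ :=
  ∑ E ∈ (allEdges n).powerset, erProb n p E * X E

/-- Degree of the node `i` in the graph with edge set `E`. -/
def deg (n : ℕ) (E : Finset (Sym2 (Fin n))) (i : Fin n) : ℕ :=
  (Finset.univ.filter fun j => j ≠ i ∧ s(i, j) ∈ E).card

/-- Truncated inverse degree `f_i`. -/
def finv (n : ℕ) (E : Finset (Sym2 (Fin n))) (i : Fin n) : ℝ :=
  if deg n E i = 0 then 0 else 1 / (deg n E i : ℝ)

/-- The opinion-dynamics matrix `H(G)` with condescendence parameters `α`. -/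
def Hmat (n : ℕ) (α : Fin n → ℝ) (E : Finset (Sym2 (Fin n))) : Matrix (Fin n) (Fin n) ℝ :=
  Matrix.of fun i j =>
    if deg n E i = 0 then (if i = j then α i else 0)
    else if i ≠ j ∧ s(i, j) ∈ E then α i / (deg n E i : ℝ) else 0

/-- Entrywise expectation of a random matrix in the Erdős–Rényi model `G(n,p)`. -/
def erExpMat (n : ℕ) (p : ℝ) (M : Finset (Sym2 (Fin n)) → Matrix (Fin n) (Fin n) ℝ) :
    Matrix (Fin n) (Fin n) ℝ :=
  Matrix.of fun i j => erExp n p fun E => M E i j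

/-- Conditional expectation `E(X | A)` given an event `A`. -/
def erCondExp (n : ℕ) (p : ℝ) (X : Finset (Sym2 (Fin n)) → ℝ)
    (A : Finset (Sym2 (Fin n)) → Prop) : ℝ :=
  erExp n p (fun E => if A E then X E else 0) / erExp n p (fun E => if A E then 1 else 0)

/-- The matrix norm `‖M‖_* = max_i Σ_j |M i j|` induced by the `ℓ∞` norm. -/
def starNorm {n : ℕ} (M : Matrix (Fin n) (Fin n) ℝ) : ℝ :=
  ⨆ i, ∑ j, |M i j|

/-- The opinion-dynamics iterates `x(G,t)`: `x(G,0) = x0`,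
`x(G,t+1) = H x(G,t) + B x0`. -/
def dyn (n : ℕ) (H B : Matrix (Fin n) (Fin n) ℝ) (x0 : Fin n → ℝ) : ℕ → Fin n → ℝ
  | 0 => x0
  | t + 1 => H *ᵥ dyn n H B x0 t + B *ᵥ x0

/-! ### Expectations in the Erdős–Rényi model -/

lemma erExp_prod (n : ℕ) (p : ℝ) (g : Sym2 (Fin n) → ℝ) :
    erExp n p (fun E => ∏ e ∈ E, g e) = ∏ e ∈ allEdges n, (p * g e + (1 - p)) := by
  rw [Finset.prod_add]
  refine Finset.sum_congr rfl fun E hE => ?_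
  rw [Finset.mem_powerset] at hE
  rw [Finset.prod_mul_distrib, Finset.prod_const, Finset.prod_const, Finset.card_sdiff_of_subset hE,
    erProb]
  ring

lemma erExp_const (n : ℕ) (p a : ℝ) : erExp n p (fun _ => a) = a := by
  have h := erExp_prod n p fun _ => 1
  simp only [Finset.prod_const_one, mul_one, add_sub_cancel] at h
  simp only [erExp, mul_one] at h
  rw [erExp, ← Finset.sum_mul, h, one_mul]

lemma erExp_add (n : ℕ) (p : ℝ) (X Y : Finset (Sym2 (Fin n)) → ℝ) :
    erExp n p (fun E => X E + Y E) = erExp n p X + erExp n p Y := by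
  simp only [erExp, mul_add, Finset.sum_add_distrib]

lemma erExp_sub (n : ℕ) (p : ℝ) (X Y : Finset (Sym2 (Fin n)) → ℝ) :
    erExp n p (fun E => X E - Y E) = erExp n p X - erExp n p Y := by
  simp only [erExp, mul_sub, Finset.sum_sub_distrib]

lemma erExp_const_mul (n : ℕ) (p a : ℝ) (X : Finset (Sym2 (Fin n)) → ℝ) :
    erExp n p (fun E => a * X E) = a * erExp n p X := by
  simp only [erExp, Finset.mul_sum]
  exact Finset.sum_congr rfl fun _ _ => by ring

lemma erExp_sum {ι : Type*} (n : ℕ) (p : ℝ) (s : Finset ι)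
    (X : ι → Finset (Sym2 (Fin n)) → ℝ) :
    erExp n p (fun E => ∑ k ∈ s, X k E) = ∑ k ∈ s, erExp n p (X k) := by
  simp only [erExp, Finset.mul_sum]
  exact Finset.sum_comm

lemma erProb_nonneg (n : ℕ) {p : ℝ} (hp : p ∈ Set.Ioo (0 : ℝ) 1) (E : Finset (Sym2 (Fin n))) :
    0 ≤ erProb n p E :=
  mul_nonneg (pow_nonneg hp.1.le _) (pow_nonneg (sub_nonneg.2 hp.2.le) _)

lemma erExp_mono (n : ℕ) {p : ℝ} (hp : p ∈ Set.Ioo (0 : ℝ) 1) {X Y : Finset (Sym2 (Fin n)) → ℝ}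
    (h : ∀ E, X E ≤ Y E) : erExp n p X ≤ erExp n p Y :=
  Finset.sum_le_sum fun E _ => mul_le_mul_of_nonneg_left (h E) (erProb_nonneg n hp E)

lemma abs_erExp_le (n : ℕ) {p : ℝ} (hp : p ∈ Set.Ioo (0 : ℝ) 1)
    {X Y : Finset (Sym2 (Fin n)) → ℝ} (h : ∀ E, |X E| ≤ Y E) : |erExp n p X| ≤ erExp n p Y := by
  have hneg : -erExp n p Y = erExp n p (fun E => -Y E) := by
    simp only [erExp, mul_neg, Finset.sum_neg_distrib]
  rw [abs_le, hneg]
  exact ⟨erExp_mono n hp fun E => (abs_le.1 (h E)).1, erExp_mono n hp fun E => (abs_le.1 (h E)).2⟩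

/-! ### Sums over neighbours -/

/-- The sum of `c` over the neighbours of `i` in the graph with edge set `E`. -/
def nbrSum (n : ℕ) (E : Finset (Sym2 (Fin n))) (i : Fin n) (c : Fin n → ℝ) : ℝ :=
  ∑ j, if j ≠ i ∧ s(i, j) ∈ E then c j else 0

lemma nbrSum_const (n : ℕ) (E : Finset (Sym2 (Fin n))) (i : Fin n) (a : ℝ) :
    nbrSum n E i (fun _ => a) = deg n E i * a := by
  simp [nbrSum, deg, Finset.sum_ite]

lemma nbrSum_sub (n : ℕ) (E : Finset (Sym2 (Fin n))) (i : Fin n) (c d : Fin n → ℝ) :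
    nbrSum n E i (fun j => c j - d j) = nbrSum n E i c - nbrSum n E i d := by
  rw [nbrSum, nbrSum, nbrSum, ← Finset.sum_sub_distrib]
  exact Finset.sum_congr rfl fun j _ => by split_ifs <;> simp

/-- The weight that the edge `e` contributes to `nbrSum n E i c`. -/
def edgeWeight (n : ℕ) (i : Fin n) (c : Fin n → ℝ) (e : Sym2 (Fin n)) : ℝ :=
  ∑ j, if j ≠ i ∧ s(i, j) = e then c j else 0

lemma nbrSum_eq_sum_edgeWeight (n : ℕ) (E : Finset (Sym2 (Fin n))) (i : Fin n) (c : Fin n → ℝ) :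
    nbrSum n E i c = ∑ e ∈ E, edgeWeight n i c e := by
  simp only [edgeWeight, nbrSum]
  rw [Finset.sum_comm]
  refine Finset.sum_congr rfl fun j _ => ?_
  by_cases hj : j = i <;> simp [hj]

lemma comp_edgeWeight (n : ℕ) (i : Fin n) (c : Fin n → ℝ) (φ : ℝ → ℝ) (hφ : φ 0 = 0)
    (e : Sym2 (Fin n)) : φ (edgeWeight n i c e) = edgeWeight n i (fun j => φ (c j)) e := by
  by_cases h : ∃ k, k ≠ i ∧ s(i, k) = e
  · obtain ⟨k, hk, rfl⟩ := h
    have key : ∀ d : Fin n → ℝ, edgeWeight n i d s(i, k) = d k := by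
      intro d
      rw [edgeWeight, Finset.sum_eq_single k]
      · simp [hk]
      · rintro j _ hj
        exact if_neg fun h => hj (Sym2.congr_right.1 h.2)
      · simp
    rw [key, key]
  · push Not at h
    have key : ∀ d : Fin n → ℝ, edgeWeight n i d e = 0 := fun d =>
      Finset.sum_eq_zero fun j _ => if_neg fun hj => h j hj.1 hj.2
    rw [key, key, hφ]

lemma nbrSum_allEdges (n : ℕ) (i : Fin n) (c : Fin n → ℝ) :
    nbrSum n (allEdges n) i c = ∑ j ∈ univ.erase i, c j := by
  rw [nbrSum, ← Finset.sum_filter]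
  refine Finset.sum_congr ?_ fun _ _ => rfl
  ext j
  simp [allEdges, eq_comm]

/-- A moment generating function bound for sums over neighbours. -/
lemma erExp_exp_nbrSum_le (n : ℕ) {p : ℝ} (hp : p ∈ Set.Ioo (0 : ℝ) 1) (i : Fin n)
    (c : Fin n → ℝ) (hc : ∀ j, |c j| ≤ 1) {t : ℝ} (ht : t ∈ Set.Icc (0 : ℝ) 1) :
    erExp n p (fun E => Real.exp (t * nbrSum n E i c)) ≤
      Real.exp (p * (t * ∑ j ∈ univ.erase i, c j + t ^ 2 * ((n : ℝ) - 1))) := by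
  have hn : 1 ≤ n := i.pos
  have h1 : ∀ E : Finset (Sym2 (Fin n)), Real.exp (t * nbrSum n E i c) =
      ∏ e ∈ E, Real.exp (t * edgeWeight n i c e) := fun E => by
    rw [nbrSum_eq_sum_edgeWeight, Finset.mul_sum, Real.exp_sum]
  simp only [h1]
  rw [erExp_prod]
  have h2 : ∀ e, p * Real.exp (t * edgeWeight n i c e) + (1 - p) ≤
      Real.exp (p * edgeWeight n i (fun j => Real.exp (t * c j) - 1) e) := fun e => by
    rw [← comp_edgeWeight n i c (fun x => Real.exp (t * x) - 1) (by simp)]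
    have := Real.add_one_le_exp (p * (Real.exp (t * edgeWeight n i c e) - 1))
    linarith
  refine (Finset.prod_le_prod (fun e _ => ?_) fun e _ => h2 e).trans ?_
  · exact add_nonneg (mul_nonneg hp.1.le (Real.exp_pos _).le) (sub_nonneg.2 hp.2.le)
  rw [← Real.exp_sum, ← Finset.mul_sum, ← nbrSum_eq_sum_edgeWeight, nbrSum_allEdges]
  refine Real.exp_le_exp.2 (mul_le_mul_of_nonneg_left ?_ hp.1.le)
  have h3 : ∀ j, Real.exp (t * c j) - 1 ≤ t * c j + t ^ 2 := fun j => by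
    have hcj := hc j
    have habs : |t * c j| ≤ t := by
      rw [abs_mul, abs_of_nonneg ht.1]
      exact mul_le_of_le_one_right ht.1 hcj
    have h4 := (abs_le.1 (Real.abs_exp_sub_one_sub_id_le (habs.trans ht.2))).2
    have h5 : (t * c j) ^ 2 ≤ t ^ 2 := sq_le_sq' (by linarith [(abs_le.1 habs).1])
      (abs_le.1 habs).2
    linarith
  refine (Finset.sum_le_sum fun j _ => h3 j).trans_eq ?_
  rw [Finset.sum_add_distrib, ← Finset.mul_sum, Finset.sum_const, nsmul_eq_mul,
    Finset.card_erase_of_mem (Finset.mem_univ i), Finset.card_univ, Fintype.card_fin,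
    Nat.cast_sub hn]
  push_cast
  ring

/-- An exponential majorant of the event that `nbrSum n E i c` exceeds its mean by at least
`η * (p * (n - 1))`. -/
def devExp (n : ℕ) (p η : ℝ) (i : Fin n) (c : Fin n → ℝ) (E : Finset (Sym2 (Fin n))) : ℝ :=
  Real.exp (η / 2 * (nbrSum n E i c - p * ∑ j ∈ univ.erase i, c j - η * (p * ((n : ℝ) - 1))))

/-- A Chernoff-type bound for sums over neighbours. -/
lemma erExp_devExp_le (n : ℕ) {p : ℝ} (hp : p ∈ Set.Ioo (0 : ℝ) 1) (i : Fin n)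
    (c : Fin n → ℝ) (hc : ∀ j, |c j| ≤ 1) {η : ℝ} (hη : η ∈ Set.Icc (0 : ℝ) 1) :
    erExp n p (devExp n p η i c) ≤
      Real.exp (-(η ^ 2 / 4 * (p * ((n : ℝ) - 1)))) := by
  have h := erExp_exp_nbrSum_le n hp i c hc (t := η / 2)
    ⟨by linarith [hη.1], by linarith [hη.2]⟩
  have h1 : devExp n p η i c = fun E =>
      Real.exp (-(η / 2) * (p * ∑ j ∈ univ.erase i, c j + η * (p * ((n : ℝ) - 1)))) *
        Real.exp (η / 2 * nbrSum n E i c) := by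
    funext E
    rw [devExp, ← Real.exp_add]
    ring_nf
  rw [h1, erExp_const_mul]
  refine (mul_le_mul_of_nonneg_left h (Real.exp_pos _).le).trans_eq ?_
  rw [← Real.exp_add]
  ring_nf

/-! ### Substochastic matrices and the opinion dynamics -/

/-- A matrix with nonnegative entries whose `i`-th row sums to `α i`. -/
def HasRowSums {n : ℕ} (α : Fin n → ℝ) (M : Matrix (Fin n) (Fin n) ℝ) : Prop :=
  (∀ i j, 0 ≤ M i j) ∧ ∀ i, ∑ j, M i j = α i

lemma HasRowSums.norm_mulVec_le {n : ℕ} {α : Fin n → ℝ} {M : Matrix (Fin n) (Fin n) ℝ}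
    (hM : HasRowSums α M) {a : ℝ} (ha : 0 ≤ a) (hα : ∀ i, α i ≤ a) (v : Fin n → ℝ) :
    ‖M *ᵥ v‖ ≤ a * ‖v‖ := by
  refine (pi_norm_le_iff_of_nonneg (mul_nonneg ha (norm_nonneg v))).2 fun i => ?_
  calc ‖(M *ᵥ v) i‖ ≤ ∑ j, ‖M i j * v j‖ := norm_sum_le univ fun j => M i j * v j
    _ ≤ ∑ j, M i j * ‖v‖ := Finset.sum_le_sum fun j _ => by
        rw [norm_mul, Real.norm_of_nonneg (hM.1 i j)]
        exact mul_le_mul_of_nonneg_left (norm_le_pi_norm v j) (hM.1 i j)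
    _ = α i * ‖v‖ := by rw [← Finset.sum_mul, hM.2]
    _ ≤ a * ‖v‖ := mul_le_mul_of_nonneg_right (hα i) (norm_nonneg v)

lemma HasRowSums.inv_mulVec_eq {n : ℕ} {α : Fin n → ℝ} {M : Matrix (Fin n) (Fin n) ℝ}
    (hM : HasRowSums α M) {a : ℝ} (ha : a ∈ Set.Ioo (0 : ℝ) 1) (hα : ∀ i, α i ≤ a)
    (b : Fin n → ℝ) :
    (1 - M)⁻¹ *ᵥ b = M *ᵥ ((1 - M)⁻¹ *ᵥ b) + b := by
  have hinj : Function.Injective (1 - M).mulVec := by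
    intro v w hvw
    simp only [Matrix.sub_mulVec, Matrix.one_mulVec] at hvw
    have h : v - w = M *ᵥ (v - w) := by
      rw [Matrix.mulVec_sub]
      linear_combination hvw
    have h1 := hM.norm_mulVec_le ha.1.le hα (v - w)
    rw [← h] at h1
    have h2 : ‖v - w‖ = 0 := by nlinarith [norm_nonneg (v - w), ha.2]
    exact sub_eq_zero.1 (norm_eq_zero.1 h2)
  have hu : IsUnit (1 - M) := Matrix.mulVec_injective_iff_isUnit.1 hinj
  have h : (1 - M) *ᵥ ((1 - M)⁻¹ *ᵥ b) = b := by
    rw [Matrix.mulVec_mulVec, Matrix.mul_nonsing_inv _ ((Matrix.isUnit_iff_isUnit_det _).1 hu),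
      Matrix.one_mulVec]
  rw [Matrix.sub_mulVec, Matrix.one_mulVec] at h
  linear_combination h

lemma HasRowSums.tendsto_dyn {n : ℕ} {α : Fin n → ℝ} {M : Matrix (Fin n) (Fin n) ℝ}
    (hM : HasRowSums α M) {a : ℝ} (ha : a ∈ Set.Ioo (0 : ℝ) 1) (hα : ∀ i, α i ≤ a)
    (B : Matrix (Fin n) (Fin n) ℝ) (x0 : Fin n → ℝ) :
    Tendsto (dyn n M B x0) atTop (𝓝 ((1 - M)⁻¹ *ᵥ (B *ᵥ x0))) := by
  set x := (1 - M)⁻¹ *ᵥ (B *ᵥ x0) with hx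
  have hfix : x = M *ᵥ x + B *ᵥ x0 := hM.inv_mulVec_eq ha hα _
  have hbound : ∀ t, ‖dyn n M B x0 t - x‖ ≤ a ^ t * ‖x0 - x‖ := by
    intro t
    induction t with
    | zero => simp [dyn]
    | succ t ih =>
      have h : dyn n M B x0 (t + 1) - x = M *ᵥ (dyn n M B x0 t - x) := by
        rw [Matrix.mulVec_sub, dyn]
        nth_rewrite 1 [hfix]
        abel
      rw [h, pow_succ', mul_assoc]
      exact (hM.norm_mulVec_le ha.1.le hα _).trans (mul_le_mul_of_nonneg_left ih ha.1.le)
  rw [tendsto_iff_norm_sub_tendsto_zero]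
  refine squeeze_zero (fun _ => norm_nonneg _) hbound ?_
  simpa using (tendsto_pow_atTop_nhds_zero_of_lt_one ha.1.le ha.2).mul_const ‖x0 - x‖

lemma HasRowSums.mulVec_mem_Icc {n : ℕ} {α : Fin n → ℝ} {M : Matrix (Fin n) (Fin n) ℝ}
    (hM : HasRowSums α M) {v : Fin n → ℝ} (hv : ∀ i, v i ∈ Set.Icc (0 : ℝ) 1) (i : Fin n) :
    (M *ᵥ v) i ∈ Set.Icc 0 (α i) := by
  rw [Matrix.mulVec, dotProduct, ← hM.2 i]
  refine ⟨Finset.sum_nonneg fun j _ => mul_nonneg (hM.1 i j) (hv j).1, ?_⟩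
  exact Finset.sum_le_sum fun j _ => mul_le_of_le_one_right (hM.1 i j) (hv j).2

lemma HasRowSums.stable_mem_Icc {n : ℕ} {α : Fin n → ℝ} {M : Matrix (Fin n) (Fin n) ℝ}
    (hM : HasRowSums α M) {a : ℝ} (ha : a ∈ Set.Ioo (0 : ℝ) 1) (hα : ∀ i, α i ≤ a)
    {x0 : Fin n → ℝ} (hx0 : ∀ i, x0 i ∈ Set.Icc (0 : ℝ) 1) (i : Fin n) :
    ((1 - M)⁻¹ *ᵥ (Matrix.diagonal (fun i => 1 - α i) *ᵥ x0)) i ∈ Set.Icc (0 : ℝ) 1 := by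
  have hdyn : ∀ t i, dyn n M (Matrix.diagonal fun i => 1 - α i) x0 t i ∈ Set.Icc (0 : ℝ) 1 := by
    intro t
    induction t with
    | zero => exact hx0
    | succ t ih =>
      intro i
      have h1 := hM.mulVec_mem_Icc ih i
      have h2 : 0 ≤ 1 - α i := by linarith [hα i, ha.2]
      have h3 := mul_nonneg h2 (hx0 i).1
      have h4 := mul_le_of_le_one_right h2 (hx0 i).2
      simp only [dyn, Pi.add_apply, Matrix.mulVec_diagonal]
      exact ⟨by linarith [h1.1], by linarith [h1.2]⟩
  exact isClosed_Icc.mem_of_tendsto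
    (tendsto_pi_nhds.1 (hM.tendsto_dyn ha hα _ x0) i) (Eventually.of_forall fun t => hdyn t i)

/-- Perturbation bound for fixed points of the opinion dynamics. -/
lemma HasRowSums.norm_inv_mulVec_sub_le {n : ℕ} {α : Fin n → ℝ} {M : Matrix (Fin n) (Fin n) ℝ}
    (hM : HasRowSums α M) {a : ℝ} (ha : a ∈ Set.Ioo (0 : ℝ) 1) (hα : ∀ i, α i ≤ a)
    {N : Matrix (Fin n) (Fin n) ℝ} {b y : Fin n → ℝ} (hy : y = N *ᵥ y + b) :
    ‖(1 - M)⁻¹ *ᵥ b - y‖ ≤ (1 - a)⁻¹ * ‖M *ᵥ y - N *ᵥ y‖ := by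
  set x := (1 - M)⁻¹ *ᵥ b with hx
  have hfix : x = M *ᵥ x + b := hM.inv_mulVec_eq ha hα b
  have h : x - y = M *ᵥ (x - y) + (M *ᵥ y - N *ᵥ y) := by
    rw [Matrix.mulVec_sub]
    linear_combination hfix - hy
  have h1 : ‖x - y‖ ≤ a * ‖x - y‖ + ‖M *ᵥ y - N *ᵥ y‖ := by
    conv_lhs => rw [h]
    exact (norm_add_le _ _).trans (add_le_add_left (hM.norm_mulVec_le ha.1.le hα _) _)
  rw [inv_mul_eq_div, le_div_iff₀ (sub_pos.2 ha.2)]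
  linarith

lemma Hmat_mulVec_of_deg_ne_zero {n : ℕ} {E : Finset (Sym2 (Fin n))} {i : Fin n}
    (h : deg n E i ≠ 0) (α v : Fin n → ℝ) :
    (Hmat n α E *ᵥ v) i = α i / deg n E i * nbrSum n E i v := by
  rw [Matrix.mulVec, dotProduct, nbrSum, Finset.mul_sum]
  refine Finset.sum_congr rfl fun j _ => ?_
  simp only [Hmat, Matrix.of_apply, if_neg h, ne_comm (a := i)]
  split_ifs <;> simp

lemma hasRowSums_Hmat {n : ℕ} {α : Fin n → ℝ} (hα : ∀ i, 0 ≤ α i) (E : Finset (Sym2 (Fin n))) :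
    HasRowSums α (Hmat n α E) := by
  refine ⟨fun i j => ?_, fun i => ?_⟩
  · have := hα i
    simp only [Hmat, Matrix.of_apply]
    split_ifs <;> positivity
  · by_cases h : deg n E i = 0
    · simp [Hmat, h]
    · have h1 := Hmat_mulVec_of_deg_ne_zero h α fun _ => 1
      rw [nbrSum_const, mul_one, div_mul_cancel₀ _ (Nat.cast_ne_zero.2 h)] at h1
      simpa [Matrix.mulVec, dotProduct] using h1

lemma HasRowSums.erExpMat {n : ℕ} {p : ℝ} (hp : p ∈ Set.Ioo (0 : ℝ) 1) {α : Fin n → ℝ}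
    {M : Finset (Sym2 (Fin n)) → Matrix (Fin n) (Fin n) ℝ} (hM : ∀ E, HasRowSums α (M E)) :
    HasRowSums α (erExpMat n p M) := by
  refine ⟨fun i j => ?_, fun i => ?_⟩
  · rw [← erExp_const n p 0]
    exact erExp_mono n hp fun E => (hM E).1 i j
  · simp only [_root_.erExpMat, Matrix.of_apply]
    rw [← erExp_sum]
    simp only [(hM _).2]
    exact erExp_const n p _

lemma erExpMat_mulVec (n : ℕ) (p : ℝ) (M : Finset (Sym2 (Fin n)) → Matrix (Fin n) (Fin n) ℝ)
    (v : Fin n → ℝ) (i : Fin n) :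
    (erExpMat n p M *ᵥ v) i = erExp n p fun E => (M E *ᵥ v) i := by
  simp only [Matrix.mulVec, dotProduct, erExpMat, Matrix.of_apply, erExp_sum]
  refine Finset.sum_congr rfl fun j _ => ?_
  simp only [mul_comm _ (v j), erExp_const_mul]

/-! ### Concentration of neighbourhood averages -/

/-- The average of `v` over all nodes other than `i`. -/
def othersAvg (n : ℕ) (v : Fin n → ℝ) (i : Fin n) : ℝ :=
  (∑ j ∈ univ.erase i, v j) / ((n : ℝ) - 1)

/-- The sum of all exponential deviations controlling the neighbourhood averages of `v`. -/
def totalDev (n : ℕ) (p η : ℝ) (v : Fin n → ℝ) (E : Finset (Sym2 (Fin n))) : ℝ :=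
  ∑ i, (devExp n p η i (fun j => v j - othersAvg n v i) E +
    devExp n p η i (fun j => othersAvg n v i - v j) E + devExp n p η i (fun _ => -1) E)

lemma card_erase_cast {n : ℕ} (i : Fin n) : ((univ.erase i).card : ℝ) = (n : ℝ) - 1 := by
  rw [Finset.card_erase_of_mem (Finset.mem_univ i), Finset.card_univ, Fintype.card_fin,
    Nat.cast_sub i.pos, Nat.cast_one]

lemma othersAvg_mem_Icc {n : ℕ} {v : Fin n → ℝ} (hv : ∀ i, v i ∈ Set.Icc (0 : ℝ) 1)
    (i : Fin n) : othersAvg n v i ∈ Set.Icc (0 : ℝ) 1 := by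
  rw [othersAvg, ← card_erase_cast i]
  refine ⟨div_nonneg (Finset.sum_nonneg fun j _ => (hv j).1) (Nat.cast_nonneg _),
    div_le_one_of_le₀ ?_ (Nat.cast_nonneg _)⟩
  calc ∑ j ∈ univ.erase i, v j ≤ ∑ j ∈ univ.erase i, (1 : ℝ) :=
        Finset.sum_le_sum fun j _ => (hv j).2
    _ = _ := by simp

lemma sum_sub_othersAvg {n : ℕ} (hn : 2 ≤ n) (v : Fin n → ℝ) (i : Fin n) :
    ∑ j ∈ univ.erase i, (v j - othersAvg n v i) = 0 := by
  have h : (n : ℝ) - 1 ≠ 0 := by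
    have : (2 : ℝ) ≤ n := by exact_mod_cast hn
    linarith
  rw [Finset.sum_sub_distrib, Finset.sum_const, nsmul_eq_mul, card_erase_cast, othersAvg,
    mul_div_cancel₀ _ h, sub_self]

lemma erExp_totalDev_le {n : ℕ} {p : ℝ} (hp : p ∈ Set.Ioo (0 : ℝ) 1) {η : ℝ}
    (hη : η ∈ Set.Icc (0 : ℝ) 1) {v : Fin n → ℝ} (hv : ∀ i, v i ∈ Set.Icc (0 : ℝ) 1) :
    erExp n p (totalDev n p η v) ≤ n * (3 * Real.exp (-(η ^ 2 / 4 * (p * ((n : ℝ) - 1))))) := by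
  have hsum : ∀ i : Fin n, erExp n p (fun E => devExp n p η i (fun j => v j - othersAvg n v i) E +
      devExp n p η i (fun j => othersAvg n v i - v j) E + devExp n p η i (fun _ => -1) E) ≤
      3 * Real.exp (-(η ^ 2 / 4 * (p * ((n : ℝ) - 1)))) := by
    intro i
    have hm := othersAvg_mem_Icc hv i
    rw [erExp_add, erExp_add]
    have h1 := erExp_devExp_le n hp i (fun j => v j - othersAvg n v i)
      (fun j => abs_le.2 ⟨by linarith [(hv j).1, hm.2], by linarith [(hv j).2, hm.1]⟩) hη
    have h2 := erExp_devExp_le n hp i (fun j => othersAvg n v i - v j)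
      (fun j => abs_le.2 ⟨by linarith [(hv j).2, hm.1], by linarith [(hv j).1, hm.2]⟩) hη
    have h3 := erExp_devExp_le n hp i (fun _ => -1) (fun _ => by simp) hη
    linarith
  unfold totalDev
  rw [erExp_sum]
  refine (Finset.sum_le_sum fun i _ => hsum i).trans_eq ?_
  rw [Finset.sum_const, nsmul_eq_mul, Finset.card_univ, Fintype.card_fin]

lemma totalDev_nonneg (n : ℕ) (p η : ℝ) (v : Fin n → ℝ) (E : Finset (Sym2 (Fin n))) :
    0 ≤ totalDev n p η v E :=
  Finset.sum_nonneg fun _ _ =>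
    add_nonneg (add_nonneg (Real.exp_pos _).le (Real.exp_pos _).le) (Real.exp_pos _).le

lemma abs_Hmat_mulVec_sub_le {n : ℕ} (hn : 2 ≤ n) {p : ℝ} (hp : p ∈ Set.Ioo (0 : ℝ) 1) {η : ℝ}
    (hη : η ∈ Set.Ioc (0 : ℝ) (1 / 2)) {α : Fin n → ℝ} (hα : ∀ i, α i ∈ Set.Icc (0 : ℝ) 1)
    {v : Fin n → ℝ} (hv : ∀ i, v i ∈ Set.Icc (0 : ℝ) 1) (E : Finset (Sym2 (Fin n)))
    (i : Fin n) :
    |(Hmat n α E *ᵥ v) i - α i * othersAvg n v i| ≤ 2 * η + totalDev n p η v E := by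
  set m := othersAvg n v i with hm_def
  have hm : m ∈ Set.Icc (0 : ℝ) 1 := othersAvg_mem_Icc hv i
  have hn1 : (0 : ℝ) < n - 1 := by
    have : (2 : ℝ) ≤ n := by exact_mod_cast hn
    linarith
  have hpn : 0 < p * ((n : ℝ) - 1) := mul_pos hp.1 hn1
  have hsum : devExp n p η i (fun j => v j - m) E + devExp n p η i (fun j => m - v j) E +
      devExp n p η i (fun _ => -1) E ≤ totalDev n p η v E := by
    refine Finset.single_le_sum (f := fun i => devExp n p η i (fun j => v j - othersAvg n v i) E +
      devExp n p η i (fun j => othersAvg n v i - v j) E + devExp n p η i (fun _ => -1) E)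
      (fun _ _ => ?_) (Finset.mem_univ i)
    exact add_nonneg (add_nonneg (Real.exp_pos _).le (Real.exp_pos _).le) (Real.exp_pos _).le
  have hpos : ∀ c, 0 < devExp n p η i c E := fun c => Real.exp_pos _
  have hsmall : ∀ c, devExp n p η i c E < 1 →
      nbrSum n E i c - p * ∑ j ∈ univ.erase i, c j < η * (p * ((n : ℝ) - 1)) := by
    intro c hc
    have h := Real.exp_lt_one_iff.1 hc
    have h' := neg_of_mul_neg_right h (by linarith [hη.1])
    linarith
  rcases le_or_gt 1 (totalDev n p η v E) with hbig | hlt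
  · have h1 := (hasRowSums_Hmat (fun i => (hα i).1) E).mulVec_mem_Icc hv i
    have h2 := mul_nonneg (hα i).1 hm.1
    have h3 := mul_le_of_le_one_right (hα i).1 hm.2
    have h4 := (hα i).2
    rw [abs_le]
    exact ⟨by linarith [h1.1, hη.1], by linarith [h1.2, hη.1]⟩
  · have p1 := hpos fun j => v j - m
    have p2 := hpos fun j => m - v j
    have p3 := hpos fun _ => -1
    have h1 := hsmall (fun j => v j - m) (by linarith)
    have h2 := hsmall (fun j => m - v j) (by linarith)
    have h3 := hsmall (fun _ => -1) (by linarith)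
    have hz := sum_sub_othersAvg hn v i
    have hz' : ∑ j ∈ univ.erase i, (m - v j) = 0 := by
      rw [← neg_eq_zero, ← Finset.sum_neg_distrib, ← hz]
      simp [hm_def]
    rw [hz, mul_zero, sub_zero, nbrSum_sub, nbrSum_const] at h1
    rw [hz', mul_zero, sub_zero, nbrSum_sub, nbrSum_const] at h2
    rw [nbrSum_const, Finset.sum_const, nsmul_eq_mul, card_erase_cast] at h3
    have hD : p * ((n : ℝ) - 1) / 2 ≤ deg n E i := by nlinarith [hη.2]
    have hD0 : (0 : ℝ) < deg n E i := by linarith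
    have hd : deg n E i ≠ 0 := fun h => by simp [h] at hD0
    rw [Hmat_mulVec_of_deg_ne_zero hd]
    have heq : α i / deg n E i * nbrSum n E i v - α i * m =
        α i * ((nbrSum n E i v - deg n E i * m) / deg n E i) := by
      field_simp
    have hq : |(nbrSum n E i v - deg n E i * m) / deg n E i| ≤ 2 * η := by
      rw [abs_div, abs_of_pos hD0, div_le_iff₀ hD0, abs_le]
      have h5 := mul_le_mul_of_nonneg_left hD hη.1.le
      exact ⟨by linarith, by linarith⟩
    rw [heq, abs_mul, abs_of_nonneg (hα i).1]
    have h6 := mul_le_of_le_one_left (abs_nonneg ((nbrSum n E i v - deg n E i * m) / deg n E i))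
      (hα i).2
    linarith [totalDev_nonneg n p η v E]

/-- Quantitative mean-field approximation of the expected stable opinion. -/
lemma norm_erExp_stable_sub_le {n : ℕ} (hn : 2 ≤ n) {p : ℝ} (hp : p ∈ Set.Ioo (0 : ℝ) 1) {η : ℝ}
    (hη : η ∈ Set.Ioc (0 : ℝ) (1 / 2)) {α : Fin n → ℝ} (hα : ∀ i, α i ∈ Set.Icc (0 : ℝ) 1)
    {a : ℝ} (ha : a ∈ Set.Ioo (0 : ℝ) 1) (hαa : ∀ i, α i ≤ a)
    {x0 : Fin n → ℝ} (hx0 : ∀ i, x0 i ∈ Set.Icc (0 : ℝ) 1) :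
    ‖(fun i => erExp n p fun E =>
        ((1 - Hmat n α E)⁻¹ *ᵥ (Matrix.diagonal (fun i => 1 - α i) *ᵥ x0)) i) -
      (1 - erExpMat n p (Hmat n α))⁻¹ *ᵥ (Matrix.diagonal (fun i => 1 - α i) *ᵥ x0)‖ ≤
    (1 - a)⁻¹ *
      (2 * (2 * η + n * (3 * Real.exp (-(η ^ 2 / 4 * (p * ((n : ℝ) - 1))))))) := by
  set b := Matrix.diagonal (fun i => 1 - α i) *ᵥ x0 with hb
  set δ := (n : ℝ) * (3 * Real.exp (-(η ^ 2 / 4 * (p * ((n : ℝ) - 1))))) with hδ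
  have hδ0 : 0 ≤ δ := by positivity
  have hH := hasRowSums_Hmat fun i => (hα i).1
  have hHbar := HasRowSums.erExpMat hp hH
  set y := (1 - erExpMat n p (Hmat n α))⁻¹ *ᵥ b with hy
  have hy01 : ∀ i, y i ∈ Set.Icc (0 : ℝ) 1 := hHbar.stable_mem_Icc ha hαa hx0
  have hfix := hHbar.inv_mulVec_eq ha hαa b
  have ha' : 0 < (1 - a)⁻¹ := inv_pos.2 (sub_pos.2 ha.2)
  have hR : erExp n p (fun E => 2 * η + totalDev n p η y E) ≤ 2 * η + δ := by
    rw [erExp_add, erExp_const]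
    exact add_le_add_right (erExp_totalDev_le hp ⟨hη.1.le, by linarith [hη.2]⟩ hy01) _
  have hpt := abs_Hmat_mulVec_sub_le hn hp hη hα hy01
  have hbar : ∀ i, |(erExpMat n p (Hmat n α) *ᵥ y) i - α i * othersAvg n y i| ≤ 2 * η + δ := by
    intro i
    rw [erExpMat_mulVec]
    rw [← erExp_const n p (α i * othersAvg n y i)]
    rw [← erExp_sub]
    exact (abs_erExp_le n hp fun E => hpt E i).trans hR
  have hE : ∀ E, ‖(1 - Hmat n α E)⁻¹ *ᵥ b - y‖ ≤
      (1 - a)⁻¹ * ((2 * η + totalDev n p η y E) + (2 * η + δ)) := by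
    intro E
    refine ((hH E).norm_inv_mulVec_sub_le ha hαa hfix).trans
      (mul_le_mul_of_nonneg_left ?_ ha'.le)
    refine (pi_norm_le_iff_of_nonneg ?_).2 fun i => ?_
    · linarith [totalDev_nonneg n p η y E, hη.1]
    · have h1 := abs_le.1 (hpt E i)
      have h2 := abs_le.1 (hbar i)
      rw [Pi.sub_apply, Real.norm_eq_abs, abs_le]
      exact ⟨by linarith [h1.1, h2.2], by linarith [h1.2, h2.1]⟩
  have hη0 := hη.1
  refine (pi_norm_le_iff_of_nonneg (by positivity)).2 fun i => ?_
  rw [Pi.sub_apply, Real.norm_eq_abs]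
  nth_rewrite 1 [← erExp_const n p (y i)]
  rw [← erExp_sub]
  refine (abs_erExp_le n hp fun E => (norm_le_pi_norm _ i).trans (hE E)).trans ?_
  rw [erExp_const_mul, erExp_add, erExp_const]
  exact mul_le_mul_of_nonneg_left (by linarith) ha'.le

lemma tendsto_card_mul_exp_neg {p : ℕ → ℝ}
    (hreg : Tendsto (fun n : ℕ => p n / (Real.log n / n)) atTop atTop) {c : ℝ} (hc : 0 < c) :
    Tendsto (fun n : ℕ => (n : ℝ) * (3 * Real.exp (-(c * (p n * ((n : ℝ) - 1))))))
      atTop (𝓝 0) := by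
  have hlim : Tendsto (fun n : ℕ => 3 / (n : ℝ)) atTop (𝓝 0) :=
    tendsto_const_div_atTop_nhds_zero_nat 3
  refine squeeze_zero' (Eventually.of_forall fun n => by positivity) ?_ hlim
  filter_upwards [hreg.eventually_ge_atTop (4 / c), eventually_ge_atTop 2] with n h hn
  have hn2 : (2 : ℝ) ≤ n := by exact_mod_cast hn
  have hn0 : (0 : ℝ) < n := by linarith
  have hlog : 0 < Real.log n := Real.log_pos (by linarith)
  rw [le_div_iff₀ (by positivity)] at h
  have h1 : 4 * Real.log n ≤ c * (p n * n) := by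
    have := mul_le_mul_of_nonneg_left h (mul_pos hc hn0).le
    have e : c * n * (4 / c * (Real.log n / n)) = 4 * Real.log n := by field_simp
    rw [e] at this
    linarith
  have hp0 : 0 < c * p n := by
    by_contra! hneg
    nlinarith
  have h2 : 2 * Real.log n ≤ c * (p n * ((n : ℝ) - 1)) := by nlinarith
  have h3 : Real.exp (-(c * (p n * ((n : ℝ) - 1)))) ≤ 1 / (n : ℝ) ^ 2 := by
    refine (Real.exp_le_exp.2 (neg_le_neg h2)).trans_eq ?_
    rw [Real.exp_neg, mul_comm, Real.exp_mul, Real.exp_log hn0, one_div]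
    norm_num
  calc (n : ℝ) * (3 * Real.exp (-(c * (p n * ((n : ℝ) - 1)))))
      ≤ n * (3 * (1 / (n : ℝ) ^ 2)) := by gcongr
    _ = 3 / n := by field_simp

/-- **Theorem (mean-field concentration, undirected model).**
Let `G ∼ G(n,p)` with condescendence parameters `α` and initial opinions
`x0 ∈ [0,1]ⁿ`.  Under the Assumption (there is `ᾱ ∈ (0,1)` with `α n i ≤ ᾱ` for
all `n, i`) and the regime `p ≫ log n / n`, the stable opinion `x(G,∞)` (the
limit of the opinion dynamics, which exists for every graph) satisfies
`‖E(x(G,∞)) − x̄(∞)‖_∞ → 0` as `n → ∞`, where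
`x̄(∞) = (I − E(H(G)))⁻¹ B x(0)` is the stable solution of the mean-field
dynamics.  The norm on `Fin n → ℝ` is the sup norm. -/
theorem mean_field_concentration_undirected
    (p : ℕ → ℝ) (hp : ∀ n, p n ∈ Set.Ioo (0 : ℝ) 1)
    (α : (n : ℕ) → Fin n → ℝ) (hα : ∀ n i, α n i ∈ Set.Icc (0 : ℝ) 1)
    (x0 : (n : ℕ) → Fin n → ℝ) (hx0 : ∀ n i, x0 n i ∈ Set.Icc (0 : ℝ) 1)
    (hAssumption : ∃ ᾱ ∈ Set.Ioo (0 : ℝ) 1, ∀ n i, α n i ≤ ᾱ)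
    (hreg : Tendsto (fun n : ℕ => p n / (Real.log n / n)) atTop atTop) :
    ∃ xInf : (n : ℕ) → Finset (Sym2 (Fin n)) → Fin n → ℝ,
      (∀ n, ∀ E ∈ (allEdges n).powerset,
        Tendsto
          (fun t => dyn n (Hmat n (α n) E) (Matrix.diagonal fun i => 1 - α n i) (x0 n) t)
          atTop (nhds (xInf n E))) ∧
      Tendsto
        (fun n : ℕ =>
          ‖(fun i => erExp n (p n) fun E => xInf n E i) -
            (1 - erExpMat n (p n) (Hmat n (α n)))⁻¹ *ᵥ
              (Matrix.diagonal (fun i => 1 - α n i) *ᵥ x0 n)‖)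
        atTop (nhds 0) := by
  obtain ⟨a, ha, hαa⟩ := hAssumption
  refine ⟨fun n E => (1 - Hmat n (α n) E)⁻¹ *ᵥ
    (Matrix.diagonal (fun i => 1 - α n i) *ᵥ x0 n), fun n E _ => ?_, ?_⟩
  · exact (hasRowSums_Hmat (fun i => (hα n i).1) E).tendsto_dyn ha (hαa n) _ _
  · have ha' : 0 < 1 - a := sub_pos.2 ha.2
    rw [Metric.tendsto_atTop']
    intro ε hε
    set η := min (1 / 2) (ε * (1 - a) / 8) with hη_def
    have hη : η ∈ Set.Ioc (0 : ℝ) (1 / 2) :=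
      ⟨lt_min (by norm_num) (by positivity), min_le_left _ _⟩
    have hη' : η ≤ ε * (1 - a) / 8 := min_le_right _ _
    have hc : 0 < η ^ 2 / 4 := by
      have := hη.1
      positivity
    have hδ := (tendsto_card_mul_exp_neg hreg hc).eventually_lt_const
      (show 0 < ε * (1 - a) / 4 by positivity)
    obtain ⟨N, hN⟩ := eventually_atTop.1 (hδ.and (eventually_ge_atTop 2))
    refine ⟨N, fun n hn => ?_⟩
    obtain ⟨h1, h2⟩ := hN n hn.le
    rw [dist_zero_right, norm_norm]
    refine (norm_erExp_stable_sub_le h2 (hp n) hη (hα n) ha (hαa n) (hx0 n)).trans_lt ?_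
    rw [inv_mul_eq_div, div_lt_iff₀ ha']
    linarith
end
end

section
/- Let G ∼ G(n,p) and let k < n. Let c = c_1 c_2 ⋯ c_{k+1} be a trail of size k with no two equal consecutive nodes, let {i_1,…,i_s} be the distinct nodes among c_1,…,c_k, and for each r ∈ [s] let m_r be the number of occurrences of i_r among c_1,…,c_k. Then E(f_{i_1}^{m_1} ⋯ f_{i_s}^{m_s} | 1_c = 1) ≤ ∏_{r=1}^s m_r!/(p^{m_r}(n−k)^{m_r}) ≤ k!/(p^k(n−k)^k). -/
open Finset Filter Topology Matrix

attribute [local instance] Classical.propDecidable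

noncomputable section

/-- Expectation of `X` over a random subset of `A` containing each element independently with
probability `p`. -/
def subsetExp {α : Type*} (p : ℝ) (A : Finset α) (X : Finset α → ℝ) : ℝ :=
  ∑ E ∈ A.powerset, p ^ E.card * (1 - p) ^ (A.card - E.card) * X E

section SubsetExp

variable {α ι : Type*}

theorem subsetExp_congr {p : ℝ} {A : Finset α} {X Y : Finset α → ℝ}
    (h : ∀ E ⊆ A, X E = Y E) : subsetExp p A X = subsetExp p A Y :=
  Finset.sum_congr rfl fun E hE => by rw [h E (Finset.mem_powerset.1 hE)]

theorem subsetExp_mono {p : ℝ} (h0 : 0 ≤ p) (h1 : p ≤ 1) {A : Finset α} {X Y : Finset α → ℝ}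
    (h : ∀ E ⊆ A, X E ≤ Y E) : subsetExp p A X ≤ subsetExp p A Y :=
  Finset.sum_le_sum fun E hE => mul_le_mul_of_nonneg_left (h E (Finset.mem_powerset.1 hE))
    (mul_nonneg (pow_nonneg h0 _) (pow_nonneg (sub_nonneg.2 h1) _))

theorem subsetExp_mul_left (p a : ℝ) (A : Finset α) (X : Finset α → ℝ) :
    subsetExp p A (fun E => a * X E) = a * subsetExp p A X := by
  simp only [subsetExp, Finset.mul_sum]
  exact Finset.sum_congr rfl fun E _ => by ring

theorem subsetExp_mul_right (p a : ℝ) (A : Finset α) (X : Finset α → ℝ) :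
    subsetExp p A (fun E => X E * a) = subsetExp p A X * a := by
  simp only [mul_comm _ a, subsetExp_mul_left]

variable [DecidableEq α]

theorem subsetExp_insert (p : ℝ) {A : Finset α} {a : α} (ha : a ∉ A) (X : Finset α → ℝ) :
    subsetExp p (insert a A) X =
      (1 - p) * subsetExp p A X + p * subsetExp p A (fun E => X (insert a E)) := by
  simp only [subsetExp, Finset.sum_powerset_insert ha, Finset.mul_sum,
    Finset.card_insert_of_notMem ha]
  congr 1
  · refine Finset.sum_congr rfl fun E hE => ?_
    have := Finset.card_le_card (Finset.mem_powerset.1 hE)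
    rw [Nat.sub_add_comm this, pow_succ]
    ring
  · refine Finset.sum_congr rfl fun E hE => ?_
    rw [Finset.card_insert_of_notMem fun h => ha (Finset.mem_powerset.1 hE h),
      Nat.add_sub_add_right, pow_succ]
    ring

theorem subsetExp_union (p : ℝ) {B C : Finset α} (h : Disjoint B C) (X : Finset α → ℝ) :
    subsetExp p (B ∪ C) X =
      subsetExp p B (fun E => subsetExp p C (fun E' => X (E ∪ E'))) := by
  induction B using Finset.induction_on generalizing X with
  | empty => simp [subsetExp]
  | insert a B ha ih =>
    rw [Finset.disjoint_insert_left] at h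
    rw [Finset.insert_union, subsetExp_insert p (by simp [ha, h.1]), subsetExp_insert p ha,
      ih h.2, ih h.2]
    simp only [Finset.insert_union]

/-- Independence of the cardinalities of a random subset on disjoint blocks, and of its
trace outside these blocks. -/
theorem subsetExp_prod_card_inter [DecidableEq ι] (p : ℝ) (S : Finset ι) (F : ι → Finset α)
    (R T : Finset α) (hT : T ⊆ R) (hR : ∀ i ∈ S, Disjoint (F i) R)
    (hF : ∀ i ∈ S, ∀ j ∈ S, i ≠ j → Disjoint (F i) (F j)) (g : ι → ℕ → ℝ) :
    subsetExp p (S.biUnion F ∪ R)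
        (fun E => if T ⊆ E then ∏ i ∈ S, g i (E ∩ F i).card else 0) =
      (∏ i ∈ S, subsetExp p (F i) (fun E => g i E.card)) *
        subsetExp p R (fun E => if T ⊆ E then 1 else 0) := by
  induction S using Finset.induction_on with
  | empty => simp
  | insert i S hi ih =>
    have hd : Disjoint (F i) (S.biUnion F ∪ R) := by
      rw [Finset.disjoint_union_right, Finset.disjoint_biUnion_right]
      exact ⟨fun j hj => hF i (by simp) j (by simp [hj]) (by rintro rfl; exact hi hj),
        hR i (by simp)⟩
    rw [Finset.biUnion_insert, Finset.union_assoc, subsetExp_union p hd, Finset.prod_insert hi,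
      mul_assoc, ← ih (fun j hj => hR j (by simp [hj]))
        (fun j hj l hl => hF j (by simp [hj]) l (by simp [hl])), ← subsetExp_mul_right]
    refine subsetExp_congr fun E hE => ?_
    rw [← subsetExp_mul_left]
    refine subsetExp_congr fun E' hE' => ?_
    have hTE : T ⊆ E ∪ E' ↔ T ⊆ E' := by
      refine ⟨fun h x hx => ?_, fun h => h.trans Finset.subset_union_right⟩
      refine (Finset.mem_union.1 (h hx)).resolve_left fun hxE => ?_
      exact Finset.disjoint_left.1 (hR i (by simp)) (hE hxE) (hT hx)
    have hi' : (E ∪ E') ∩ F i = E := by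
      rw [Finset.union_inter_distrib_right, Finset.inter_eq_left.2 hE,
        Finset.disjoint_iff_inter_eq_empty.1 (hd.symm.mono_left hE'), Finset.union_empty]
    have hj : ∀ j ∈ S, (E ∪ E') ∩ F j = E' ∩ F j := fun j hj => by
      rw [Finset.union_inter_distrib_right, Finset.disjoint_iff_inter_eq_empty.1
        ((hF i (by simp) j (by simp [hj]) (by rintro rfl; exact hi hj)).mono_left hE),
        Finset.empty_union]
    simp only [hTE, Finset.prod_insert hi, hi', mul_ite, mul_zero]
    rw [Finset.prod_congr rfl fun j hjS => by rw [hj j hjS]]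

end SubsetExp

theorem choose_mul_pow_le (N x m : ℕ) :
    N.choose x * (N + 1) ^ m ≤ m.factorial * (1 + x) ^ m * (N + m).choose (x + m) := by
  induction m with
  | zero => simp
  | succ m ih =>
    have h := Nat.add_one_mul_choose_eq (N + m) (x + m)
    calc N.choose x * (N + 1) ^ (m + 1) = (N + 1) * (N.choose x * (N + 1) ^ m) := by ring
      _ ≤ (N + m + 1) * (m.factorial * (1 + x) ^ m * (N + m).choose (x + m)) :=
          Nat.mul_le_mul (by lia) ih
      _ = m.factorial * (1 + x) ^ m * ((N + m + 1) * (N + m).choose (x + m)) := by ring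
      _ = m.factorial * (1 + x) ^ m * (N + m + 1).choose (x + m + 1) * (x + m + 1) := by
          rw [h]; ring
      _ ≤ m.factorial * (1 + x) ^ m * (N + m + 1).choose (x + m + 1) * ((m + 1) * (1 + x)) :=
          Nat.mul_le_mul_left _ (by nlinarith [Nat.zero_le (m * x)])
      _ = (m + 1).factorial * (1 + x) ^ (m + 1) * (N + (m + 1)).choose (x + (m + 1)) := by
          rw [Nat.factorial_succ, ← add_assoc, ← add_assoc]; ring

/-- Upper bound for the inverse moments `E((1 + X)⁻ᵐ)` of a binomial variable `X`. -/
theorem binomial_inverse_moment_le {p : ℝ} (h0 : 0 < p) (h1 : p ≤ 1) (N m : ℕ) :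
    ∑ x ∈ Finset.range (N + 1),
        (N.choose x : ℝ) * (p ^ x * (1 - p) ^ (N - x) * (1 / (1 + (x : ℝ))) ^ m) ≤
      m.factorial / (p ^ m * ((N : ℝ) + 1) ^ m) := by
  have hq : 0 ≤ 1 - p := sub_nonneg.2 h1
  have hsum : ∑ x ∈ Finset.range (N + 1),
      p ^ (m + x) * (1 - p) ^ (N - x) * ((N + m).choose (x + m) : ℝ) ≤ 1 := by
    have h := add_pow p (1 - p) (m + N)
    rw [add_sub_cancel, one_pow, add_assoc, Finset.sum_range_add] at h
    refine le_of_le_of_eq ?_ h.symm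
    refine le_add_of_nonneg_of_le (Finset.sum_nonneg fun x _ => by positivity)
      (Finset.sum_le_sum fun x _ => ?_)
    rw [Nat.add_sub_add_left, add_comm N m, add_comm x m]
  rw [le_div_iff₀ (by positivity), Finset.sum_mul]
  calc _ ≤ ∑ x ∈ Finset.range (N + 1), (m.factorial : ℝ) *
        (p ^ (m + x) * (1 - p) ^ (N - x) * ((N + m).choose (x + m) : ℝ)) := by
        refine Finset.sum_le_sum fun x _ => ?_
        have h : (N.choose x : ℝ) * (N + 1) ^ m ≤
            m.factorial * (1 + x) ^ m * (N + m).choose (x + m) := by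
          exact_mod_cast choose_mul_pow_le N x m
        have hx : (0 : ℝ) < (1 + x) ^ m := by positivity
        have h' : (N.choose x : ℝ) * (N + 1) ^ m / (1 + x) ^ m ≤
            m.factorial * (N + m).choose (x + m) := by
          rw [div_le_iff₀ hx]; linarith
        calc _ = p ^ (m + x) * (1 - p) ^ (N - x) *
              ((N.choose x : ℝ) * (N + 1) ^ m / (1 + x) ^ m) := by
              rw [one_div, inv_pow, pow_add]; field_simp
          _ ≤ p ^ (m + x) * (1 - p) ^ (N - x) * (m.factorial * (N + m).choose (x + m)) :=
              mul_le_mul_of_nonneg_left h' (by positivity)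
          _ = _ := by ring
    _ ≤ m.factorial * 1 := by
        rw [← Finset.mul_sum]
        exact mul_le_mul_of_nonneg_left hsum (by positivity)
    _ = _ := mul_one _

theorem subsetExp_inverse_pow_card_le {α : Type*} {p : ℝ} (h0 : 0 < p) (h1 : p ≤ 1)
    (A : Finset α) (m : ℕ) :
    subsetExp p A (fun E => (1 / (1 + (E.card : ℝ))) ^ m) ≤
      m.factorial / (p ^ m * ((A.card : ℝ) + 1) ^ m) := by
  refine le_trans (le_of_eq ?_) (binomial_inverse_moment_le h0 h1 A.card m)
  rw [subsetExp, Finset.sum_powerset_apply_card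
    (fun x => p ^ x * (1 - p) ^ (A.card - x) * (1 / (1 + (x : ℝ))) ^ m)]
  simp only [nsmul_eq_mul]

theorem finv_nonneg (n : ℕ) (E : Finset (Sym2 (Fin n))) (i : Fin n) : 0 ≤ finv n E i := by
  unfold finv
  split_ifs <;> positivity

/-- If `i` has a neighbour outside `W`, its inverse degree is controlled by its number of
neighbours in `W`. -/
theorem finv_le_of_mem {n : ℕ} {E : Finset (Sym2 (Fin n))} {i j : Fin n} {W : Finset (Fin n)}
    (hij : j ≠ i) (hE : s(i, j) ∈ E) (hi : i ∉ W) (hj : j ∉ W) :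
    finv n E i ≤ 1 / (1 + ((E ∩ W.image fun w => s(i, w)).card : ℝ)) := by
  have hsub : E ∩ W.image (fun w => s(i, w)) ⊆
      (W.filter fun w => s(i, w) ∈ E).image fun w => s(i, w) := by
    intro e he
    obtain ⟨he, he'⟩ := Finset.mem_inter.1 he
    obtain ⟨w, hw, rfl⟩ := Finset.mem_image.1 he'
    exact Finset.mem_image_of_mem _ (Finset.mem_filter.2 ⟨hw, he⟩)
  have hins : insert j (W.filter fun w => s(i, w) ∈ E) ⊆
      Finset.univ.filter fun w => w ≠ i ∧ s(i, w) ∈ E := by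
    intro w hw
    rw [Finset.mem_insert, Finset.mem_filter] at hw
    rw [Finset.mem_filter]
    rcases hw with rfl | ⟨hw, hwE⟩
    · exact ⟨Finset.mem_univ _, hij, hE⟩
    · exact ⟨Finset.mem_univ _, fun h => hi (h ▸ hw), hwE⟩
  have hdeg : (E ∩ W.image fun w => s(i, w)).card + 1 ≤ deg n E i := by
    have h := Finset.card_le_card hins
    rw [Finset.card_insert_of_notMem fun h => hj (Finset.mem_filter.1 h).1] at h
    exact (Nat.add_le_add_right ((Finset.card_le_card hsub).trans Finset.card_image_le) 1).trans h
  rw [finv, if_neg (by lia)]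
  refine one_div_le_one_div_of_le (by positivity) ?_
  rw [add_comm]
  exact_mod_cast hdeg

/-- Bound for the conditional expectation of a product of powers of truncated inverse degrees
of the nodes in `S`, given that the edges of `T` are present, when all nodes of `S` are incident
to `T` and the set `W` of nodes is not met by `S` or `T`. -/
theorem erCondExp_prod_finv_pow_le {n : ℕ} {p : ℝ} (h0 : 0 < p) (h1 : p < 1)
    (S W : Finset (Fin n)) (T : Finset (Sym2 (Fin n))) (m : Fin n → ℕ)
    (hTall : T ⊆ allEdges n) (hS : ∀ i ∈ S, i ∉ W) (hTW : ∀ e ∈ T, ∀ w ∈ W, w ∉ e)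
    (hST : ∀ i ∈ S, ∃ j, s(i, j) ∈ T) :
    erCondExp n p (fun E => ∏ i ∈ S, finv n E i ^ m i) (fun E => T ⊆ E) ≤
      ∏ i ∈ S, ((m i).factorial : ℝ) / (p ^ m i * ((W.card : ℝ) + 1) ^ m i) := by
  set F : Fin n → Finset (Sym2 (Fin n)) := fun i => W.image fun w => s(i, w) with hFdef
  set R := allEdges n \ S.biUnion F
  have hFall : S.biUnion F ⊆ allEdges n := by
    intro e he
    obtain ⟨i, hi, he⟩ := Finset.mem_biUnion.1 he
    obtain ⟨w, hw, rfl⟩ := Finset.mem_image.1 he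
    refine Finset.mem_filter.2 ⟨Finset.mem_univ _, fun h => hS i hi ?_⟩
    rw [Sym2.mk_isDiag_iff] at h
    exact h ▸ hw
  have hTR : T ⊆ R := by
    intro e he
    refine Finset.mem_sdiff.2 ⟨hTall he, fun he' => ?_⟩
    obtain ⟨i, hi, he'⟩ := Finset.mem_biUnion.1 he'
    obtain ⟨w, hw, rfl⟩ := Finset.mem_image.1 he'
    exact hTW _ he w hw (Sym2.mem_mk_right _ _)
  have hFR : ∀ i ∈ S, Disjoint (F i) R := fun i hi =>
    Finset.disjoint_sdiff.mono_left (Finset.subset_biUnion_of_mem F hi)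
  have hFF : ∀ i ∈ S, ∀ j ∈ S, i ≠ j → Disjoint (F i) (F j) := by
    intro i hi j hj hij
    refine Finset.disjoint_left.2 fun e he he' => ?_
    obtain ⟨w, hw, rfl⟩ := Finset.mem_image.1 he
    obtain ⟨w', hw', h⟩ := Finset.mem_image.1 he'
    rcases Sym2.eq_iff.1 h with ⟨h, -⟩ | ⟨h, -⟩
    · exact hij h.symm
    · exact hS j hj (h ▸ hw)
  have hall : allEdges n = S.biUnion F ∪ R := (Finset.union_sdiff_of_subset hFall).symm
  have hex : ∀ X, erExp n p X = subsetExp p (S.biUnion F ∪ R) X := fun X => by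
    rw [← hall]; rfl
  have hone : ∀ A : Finset (Sym2 (Fin n)), subsetExp p A (fun _ => 1) = 1 := fun A => by
    simp [subsetExp, Finset.sum_pow_mul_eq_add_pow]
  set Q := subsetExp p R (fun E => if T ⊆ E then 1 else 0)
  have hden : erExp n p (fun E => if T ⊆ E then 1 else 0) = Q := by
    have h := subsetExp_prod_card_inter p S F R T hTR hFR hFF (fun _ _ => 1)
    simp only [Finset.prod_const_one, hone, one_mul] at h
    rw [hex, h]
  have hQ0 : 0 < Q := by
    have hq : 0 < 1 - p := sub_pos.2 h1
    refine Finset.sum_pos' (fun E _ => by dsimp only; split_ifs <;> positivity)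
      ⟨T, Finset.mem_powerset.2 hTR, ?_⟩
    dsimp only
    rw [if_pos subset_rfl]
    positivity
  have hcond : erCondExp n p (fun E => ∏ i ∈ S, finv n E i ^ m i) (fun E => T ⊆ E) =
      erExp n p (fun E => if T ⊆ E then ∏ i ∈ S, finv n E i ^ m i else 0) /
        erExp n p (fun E => if T ⊆ E then 1 else 0) := by
    unfold erCondExp
    congr!
  rw [hcond, hden, div_le_iff₀ hQ0, hex]
  calc _ ≤ subsetExp p (S.biUnion F ∪ R) (fun E => if T ⊆ E then
          ∏ i ∈ S, (1 / (1 + ((E ∩ F i).card : ℝ))) ^ m i else 0) := by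
        refine subsetExp_mono h0.le h1.le fun E _ => ?_
        split_ifs with hTE
        · refine Finset.prod_le_prod (fun i _ => pow_nonneg (finv_nonneg n E i) _) fun i hi => ?_
          obtain ⟨j, hj⟩ := hST i hi
          refine pow_le_pow_left₀ (finv_nonneg n E i) (finv_le_of_mem (j := j) ?_ (hTE hj)
            (hS i hi) fun hjW => hTW _ hj j hjW (Sym2.mem_mk_right _ _)) _
          rintro rfl
          exact (Finset.mem_filter.1 (hTall hj)).2 (Sym2.mk_isDiag_iff.2 rfl)
        · exact le_rfl
    _ = _ := subsetExp_prod_card_inter p S F R T hTR hFR hFF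
        (fun i x => (1 / (1 + (x : ℝ))) ^ m i)
    _ ≤ _ := by
        refine mul_le_mul_of_nonneg_right (Finset.prod_le_prod (fun i _ => ?_) fun i _ => ?_) hQ0.le
        · have hq : 0 < 1 - p := sub_pos.2 h1
          exact Finset.sum_nonneg fun E _ => mul_nonneg
            (mul_nonneg (pow_nonneg h0.le _) (pow_nonneg hq.le _))
            (pow_nonneg (one_div_nonneg.2 (add_nonneg zero_le_one (Nat.cast_nonneg _))) _)
        · refine (subsetExp_inverse_pow_card_le h0 h1.le (F i) (m i)).trans_eq ?_
          rw [hFdef, Finset.card_image_of_injective _ fun a b h => Sym2.congr_right.1 h]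

/-- **Lemma (upper bound along a trail).**
Let `G ∼ G(n,p)`, `k < n`, and let `c = c₁⋯c_{k+1}` be a trail of size `k`
(with no two equal consecutive nodes).  Writing the product of truncated
inverse degrees grouped by the distinct nodes among `c₁,…,c_k` — i.e.
`f_{i₁}^{m₁} ⋯ f_{i_s}^{m_s} = ∏_{r=1}^k f_{c_r}`, where `m_r` is the number
of occurrences of `i_r` among `c₁,…,c_k` — we have
`E(∏_{r=1}^k f_{c_r} | 1_c = 1) ≤ ∏_{r=1}^s m_r!/(p^{m_r}(n−k)^{m_r})
  ≤ k!/(p^k (n−k)^k)`. -/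
theorem condExp_trail_upper_bound
    (n k : ℕ) (hkn : k < n) (p : ℝ) (hp : p ∈ Set.Ioo (0 : ℝ) 1)
    (c : Fin (k + 1) → Fin n)
    (hcons : ∀ r : Fin k, c r.castSucc ≠ c r.succ) :
    erCondExp n p (fun E => ∏ r : Fin k, finv n E (c r.castSucc))
        (fun E => ∀ r : Fin k, s(c r.castSucc, c r.succ) ∈ E) ≤
      ∏ i ∈ Finset.univ.image (fun r : Fin k => c r.castSucc),
        (Nat.factorial ((Finset.univ.filter fun r : Fin k => c r.castSucc = i).card) : ℝ) /
          (p ^ (Finset.univ.filter fun r : Fin k => c r.castSucc = i).card *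
            ((n : ℝ) - k) ^ (Finset.univ.filter fun r : Fin k => c r.castSucc = i).card) ∧
    (∏ i ∈ Finset.univ.image (fun r : Fin k => c r.castSucc),
        (Nat.factorial ((Finset.univ.filter fun r : Fin k => c r.castSucc = i).card) : ℝ) /
          (p ^ (Finset.univ.filter fun r : Fin k => c r.castSucc = i).card *
            ((n : ℝ) - k) ^ (Finset.univ.filter fun r : Fin k => c r.castSucc = i).card)) ≤
      (Nat.factorial k : ℝ) / (p ^ k * ((n : ℝ) - k) ^ k) := by
  have hp0 : 0 < p := hp.1
  have hnk : (0 : ℝ) < (n : ℝ) - k := sub_pos.2 (by exact_mod_cast hkn)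
  constructor
  · set S := Finset.univ.image fun r : Fin k => c r.castSucc with hSdef
    set T := Finset.univ.image fun r : Fin k => s(c r.castSucc, c r.succ) with hTdef
    set W := Finset.univ \ Finset.univ.image c with hWdef
    have hcW : ∀ r, c r ∉ W := fun r h =>
      (Finset.mem_sdiff.1 h).2 (Finset.mem_image_of_mem c (Finset.mem_univ r))
    have hW : (n : ℝ) - k ≤ W.card + 1 := by
      have h1 : (Finset.univ.image c).card ≤ k + 1 :=
        Finset.card_image_le.trans_eq (by simp)
      have h2 : W.card = n - (Finset.univ.image c).card := by
        rw [hWdef, Finset.card_sdiff_of_subset (Finset.subset_univ _), Finset.card_univ,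
          Fintype.card_fin]
      rw [sub_le_iff_le_add]
      exact_mod_cast (by lia : n ≤ W.card + 1 + k)
    have hA : (fun E : Finset (Sym2 (Fin n)) => ∀ r : Fin k, s(c r.castSucc, c r.succ) ∈ E) =
        fun E => T ⊆ E := by
      funext E
      simp [hTdef, Finset.image_subset_iff]
    have hX : (fun E => ∏ r : Fin k, finv n E (c r.castSucc)) = fun E => ∏ i ∈ S, finv n E i ^
        (Finset.univ.filter fun r : Fin k => c r.castSucc = i).card := by
      funext E
      exact Finset.prod_comp (finv n E) fun r : Fin k => c r.castSucc
    rw [hA, hX]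
    refine (erCondExp_prod_finv_pow_le hp0 hp.2 S W T _ ?_ ?_ ?_ ?_).trans
      (Finset.prod_le_prod (fun i _ => by positivity) fun i _ => ?_)
    · intro e he
      obtain ⟨r, -, rfl⟩ := Finset.mem_image.1 he
      exact Finset.mem_filter.2
        ⟨Finset.mem_univ _, fun h => hcons r (Sym2.mk_isDiag_iff.1 h)⟩
    · intro i hi
      obtain ⟨r, -, rfl⟩ := Finset.mem_image.1 hi
      exact hcW _
    · intro e he w hw hwe
      obtain ⟨r, -, rfl⟩ := Finset.mem_image.1 he
      rcases Sym2.mem_iff.1 hwe with rfl | rfl <;> exact hcW _ hw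
    · intro i hi
      obtain ⟨r, -, rfl⟩ := Finset.mem_image.1 hi
      exact ⟨_, Finset.mem_image_of_mem _ (Finset.mem_univ r)⟩
    · gcongr
  · have hsum : ∑ i ∈ Finset.univ.image (fun r : Fin k => c r.castSucc),
        (Finset.univ.filter fun r : Fin k => c r.castSucc = i).card = k := by
      rw [← Finset.card_eq_sum_card_image, Finset.card_univ, Fintype.card_fin]
    rw [Finset.prod_div_distrib, Finset.prod_mul_distrib, Finset.prod_pow_eq_pow_sum,
      Finset.prod_pow_eq_pow_sum, hsum]
    refine div_le_div_of_nonneg_right ?_ (by positivity)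
    have h := Nat.le_of_dvd (Nat.factorial_pos _) (Nat.prod_factorial_dvd_factorial_sum
      (Finset.univ.image fun r : Fin k => c r.castSucc)
      fun i => (Finset.univ.filter fun r : Fin k => c r.castSucc = i).card)
    rw [hsum] at h
    exact_mod_cast h
end
end

section
/- Let G ∼ D(n,p) be the directed Erdős–Rényi random graph with condescendence parameters α_i ∈ [0,1], and suppose the sequence p = p(n) satisfies p ≫ log(n)/n. Then for every fixed k ∈ ℕ there exists a constant C(k) > 0 such that for all sufficiently large n, ‖E(H(G)^k) − E(H(G))^k‖_* ≤ C(k)/n, which tends to 0 as n → ∞. -/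
open Finset Filter Topology Matrix

attribute [local instance] Classical.propDecidable

noncomputable section

/-- The set of possible directed edges of a simple directed graph on `Fin n`:
all ordered pairs `(i,j)` with `i ≠ j`.  A directed graph `G ∈ 𝔻ₙ` is
identified with its edge set, a subset of `allDirEdges n`. -/
def allDirEdges (n : ℕ) : Finset (Fin n × Fin n) :=
  Finset.univ.filter fun e => e.1 ≠ e.2

/-- Probability weight of a given edge set in the directed Erdős–Rényi model
`D(n,p)`. -/
def dProb (n : ℕ) (p : ℝ) (E : Finset (Fin n × Fin n)) : ℝ :=
  p ^ E.card * (1 - p) ^ ((allDirEdges n).card - E.card)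

/-- Expectation of a real random variable in the directed Erdős–Rényi model
`D(n,p)`. -/
def dExp (n : ℕ) (p : ℝ) (X : Finset (Fin n × Fin n) → ℝ) : ℝ :=
  ∑ E ∈ (allDirEdges n).powerset, dProb n p E * X E

/-- Out-degree of the node `i` in the directed graph with edge set `E`. -/
def degPlus (n : ℕ) (E : Finset (Fin n × Fin n)) (i : Fin n) : ℕ :=
  (Finset.univ.filter fun j => j ≠ i ∧ (i, j) ∈ E).card

/-- Truncated inverse out-degree `f_i`. -/
def finvD (n : ℕ) (E : Finset (Fin n × Fin n)) (i : Fin n) : ℝ :=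
  if degPlus n E i = 0 then 0 else 1 / (degPlus n E i : ℝ)

/-- The opinion-dynamics matrix `H(G)` of a directed graph, with condescendence
parameters `α`. -/
def HmatD (n : ℕ) (α : Fin n → ℝ) (E : Finset (Fin n × Fin n)) : Matrix (Fin n) (Fin n) ℝ :=
  Matrix.of fun i j =>
    if degPlus n E i = 0 then (if i = j then α i else 0)
    else if i ≠ j ∧ (i, j) ∈ E then α i / (degPlus n E i : ℝ) else 0

/-- Entrywise expectation of a random matrix in the directed Erdős–Rényi model
`D(n,p)`. -/
def dExpMat (n : ℕ) (p : ℝ) (M : Finset (Fin n × Fin n) → Matrix (Fin n) (Fin n) ℝ) :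
    Matrix (Fin n) (Fin n) ℝ :=
  Matrix.of fun i j => dExp n p fun E => M E i j

/-- Conditional expectation `E(X | A)` given an event `A`. -/
def dCondExp (n : ℕ) (p : ℝ) (X : Finset (Fin n × Fin n) → ℝ)
    (A : Finset (Fin n × Fin n) → Prop) : ℝ :=
  dExp n p (fun E => if A E then X E else 0) / dExp n p (fun E => if A E then 1 else 0)

/-- The opinion-dynamics iterates `x(G,t)`: `x(G,0) = x0`,
`x(G,t+1) = H x(G,t) + B x0`. -/
def dynD (n : ℕ) (H B : Matrix (Fin n) (Fin n) ℝ) (x0 : Fin n → ℝ) : ℕ → Fin n → ℝ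
  | 0 => x0
  | t + 1 => H *ᵥ dynD n H B x0 t + B *ᵥ x0

lemma sum_powerset_union_of_disjoint {ι M : Type*} [DecidableEq ι] [AddCommMonoid M]
    {A B : Finset ι} (h : Disjoint A B) (F : Finset ι → M) :
    ∑ E ∈ (A ∪ B).powerset, F E = ∑ S ∈ A.powerset, ∑ T ∈ B.powerset, F (S ∪ T) := by
  rw [← Finset.sum_product']
  symm
  refine Finset.sum_nbij' (fun x => x.1 ∪ x.2) (fun E => (E ∩ A, E ∩ B)) ?_ ?_ ?_ ?_ ?_
  · rintro ⟨S, T⟩ hx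
    simp only [Finset.mem_product, Finset.mem_powerset] at hx ⊢
    exact Finset.union_subset_union hx.1 hx.2
  · intro E _
    simp
  · rintro ⟨S, T⟩ hx
    simp only [Finset.mem_product, Finset.mem_powerset] at hx
    rw [Finset.disjoint_left] at h
    ext e
    · have h1 := @hx.1 e
      have h2 := @hx.2 e
      have h3 := @h e
      simp only [Finset.mem_inter, Finset.mem_union]
      tauto
    · have h1 := @hx.1 e
      have h2 := @hx.2 e
      have h3 := @h e
      simp only [Finset.mem_inter, Finset.mem_union]
      tauto
  · intro E hE
    rw [Finset.mem_powerset] at hE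
    simp only [← Finset.inter_union_distrib_left]
    exact Finset.inter_eq_left.2 hE
  · simp

/-- Probability weight of `S` as a binomial random subset of `A`. -/
def subsetWeight {ι : Type*} (p : ℝ) (A S : Finset ι) : ℝ :=
  p ^ S.card * (1 - p) ^ (A.card - S.card)

lemma sum_subsetWeight {ι : Type*} (p : ℝ) (A : Finset ι) :
    ∑ S ∈ A.powerset, subsetWeight p A S = 1 := by
  simp [subsetWeight, Finset.sum_pow_mul_eq_add_pow]

lemma subsetWeight_union {ι : Type*} [DecidableEq ι] (p : ℝ) {A B S T : Finset ι}
    (h : Disjoint A B) (hS : S ⊆ A) (hT : T ⊆ B) :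
    subsetWeight p (A ∪ B) (S ∪ T) = subsetWeight p A S * subsetWeight p B T := by
  have h1 := Finset.card_le_card hS
  have h2 := Finset.card_le_card hT
  unfold subsetWeight
  rw [Finset.card_union_of_disjoint h,
    Finset.card_union_of_disjoint (Finset.disjoint_of_subset_left hS
      (Finset.disjoint_of_subset_right hT h)),
    show A.card + B.card - (S.card + T.card) = (A.card - S.card) + (B.card - T.card) by omega,
    pow_add, pow_add]
  ring

section DirectedErdosRenyi

variable {n : ℕ} {p : ℝ}

lemma dExp_congr {X Y : Finset (Fin n × Fin n) → ℝ} (h : ∀ E, X E = Y E) :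
    dExp n p X = dExp n p Y := by
  rw [funext h]

lemma dExp_sum {ι : Type*} (s : Finset ι) (X : ι → Finset (Fin n × Fin n) → ℝ) :
    dExp n p (fun E => ∑ l ∈ s, X l E) = ∑ l ∈ s, dExp n p (X l) := by
  simp only [dExp, Finset.mul_sum]
  rw [Finset.sum_comm]

lemma dExp_const (c : ℝ) : dExp n p (fun _ => c) = c := by
  have h := sum_subsetWeight p (allDirEdges n)
  simp only [dExp, ← Finset.sum_mul]
  change (∑ E ∈ _, subsetWeight p (allDirEdges n) E) * c = c
  rw [h, one_mul]

lemma dProb_nonneg (hp : p ∈ Set.Ioo (0 : ℝ) 1) (E : Finset (Fin n × Fin n)) :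
    0 ≤ dProb n p E :=
  mul_nonneg (pow_nonneg hp.1.le _) (pow_nonneg (sub_nonneg.2 hp.2.le) _)

lemma dExp_mono (hp : p ∈ Set.Ioo (0 : ℝ) 1) {X Y : Finset (Fin n × Fin n) → ℝ}
    (h : ∀ E, X E ≤ Y E) : dExp n p X ≤ dExp n p Y :=
  Finset.sum_le_sum fun E _ => mul_le_mul_of_nonneg_left (h E) (dProb_nonneg hp E)

lemma dExp_nonneg (hp : p ∈ Set.Ioo (0 : ℝ) 1) {X : Finset (Fin n × Fin n) → ℝ}
    (h : ∀ E, 0 ≤ X E) : 0 ≤ dExp n p X :=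
  Finset.sum_nonneg fun E _ => mul_nonneg (dProb_nonneg hp E) (h E)

/-- Conditioning on the edges starting in `S` separates the weight into a product. -/
lemma dExp_split (S : Finset (Fin n)) (X : Finset (Fin n × Fin n) → ℝ) :
    dExp n p X =
      ∑ U ∈ ((allDirEdges n).filter fun e => e.1 ∈ S).powerset,
        ∑ V ∈ ((allDirEdges n).filter fun e => e.1 ∉ S).powerset,
          subsetWeight p ((allDirEdges n).filter fun e => e.1 ∈ S) U *
            subsetWeight p ((allDirEdges n).filter fun e => e.1 ∉ S) V * X (U ∪ V) := by
  set A := (allDirEdges n).filter fun e => e.1 ∈ S with hA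
  set B := (allDirEdges n).filter fun e => e.1 ∉ S with hB
  have hd : Disjoint A B := by
    rw [Finset.disjoint_left]
    intro e h1 h2
    exact (Finset.mem_filter.1 h2).2 (Finset.mem_filter.1 h1).2
  have hu : A ∪ B = allDirEdges n := by
    ext e
    simp only [hA, hB, Finset.mem_union, Finset.mem_filter]
    tauto
  have h : dExp n p X = ∑ E ∈ (allDirEdges n).powerset,
    subsetWeight p (allDirEdges n) E * X E := rfl
  rw [h]
  conv_lhs => rw [← hu]
  rw [sum_powerset_union_of_disjoint hd]
  refine Finset.sum_congr rfl fun U hU => Finset.sum_congr rfl fun V hV => ?_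
  rw [subsetWeight_union p hd (Finset.mem_powerset.1 hU) (Finset.mem_powerset.1 hV)]

/-- `X` is a function of the edges starting in `S`. -/
def DependsOnRows (X : Finset (Fin n × Fin n) → ℝ) (S : Finset (Fin n)) : Prop :=
  ∀ E, X E = X (E.filter fun e => e.1 ∈ S)

lemma DependsOnRows.mono {X : Finset (Fin n × Fin n) → ℝ} {S T : Finset (Fin n)}
    (h : DependsOnRows X S) (hST : S ⊆ T) : DependsOnRows X T := by
  intro E
  rw [h E, h (E.filter fun e => e.1 ∈ T), Finset.filter_filter]
  congr 1
  ext e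
  have := @hST e.1
  simp only [Finset.mem_filter]
  tauto

lemma DependsOnRows.mul {X Y : Finset (Fin n × Fin n) → ℝ} {S : Finset (Fin n)}
    (hX : DependsOnRows X S) (hY : DependsOnRows Y S) :
    DependsOnRows (fun E => X E * Y E) S := by
  intro E
  simp only
  rw [hX E, hY E]

lemma dExp_mul_of_disjoint {X Y : Finset (Fin n × Fin n) → ℝ} {S T : Finset (Fin n)}
    (hX : DependsOnRows X S) (hY : DependsOnRows Y T) (hST : Disjoint S T) :
    dExp n p (fun E => X E * Y E) = dExp n p X * dExp n p Y := by
  set A := (allDirEdges n).filter fun e => e.1 ∈ S with hA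
  set B := (allDirEdges n).filter fun e => e.1 ∉ S with hB
  have hXU : ∀ U ∈ A.powerset, ∀ V ∈ B.powerset, X (U ∪ V) = X U := by
    intro U hU V hV
    rw [Finset.mem_powerset] at hU hV
    rw [hX]
    congr 1
    ext e
    have h1 := @hU e
    have h2 := @hV e
    simp only [hA, hB, Finset.mem_filter, Finset.mem_union] at h1 h2 ⊢
    tauto
  have hYV : ∀ U ∈ A.powerset, ∀ V ∈ B.powerset, Y (U ∪ V) = Y V := by
    intro U hU V hV
    rw [Finset.mem_powerset] at hU hV
    rw [hY, hY V]
    congr 1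
    ext e
    have h1 := @hU e
    have h3 : e.1 ∈ S → e.1 ∉ T := fun h => Finset.disjoint_left.1 hST h
    simp only [hA, Finset.mem_filter, Finset.mem_union] at h1 ⊢
    tauto
  have hEX : dExp n p X = ∑ U ∈ A.powerset, subsetWeight p A U * X U := by
    rw [dExp_split S]
    refine Finset.sum_congr rfl fun U hU => ?_
    calc _ = ∑ V ∈ B.powerset, subsetWeight p B V * (subsetWeight p A U * X U) :=
          Finset.sum_congr rfl fun V hV => by rw [hXU U hU V hV]; ring
      _ = _ := by rw [← Finset.sum_mul, sum_subsetWeight, one_mul]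
  have hEY : dExp n p Y = ∑ V ∈ B.powerset, subsetWeight p B V * Y V := by
    rw [dExp_split S, Finset.sum_comm]
    refine Finset.sum_congr rfl fun V hV => ?_
    calc _ = ∑ U ∈ A.powerset, subsetWeight p A U * (subsetWeight p B V * Y V) :=
          Finset.sum_congr rfl fun U hU => by rw [hYV U hU V hV]; ring
      _ = _ := by rw [← Finset.sum_mul, sum_subsetWeight, one_mul]
  rw [hEX, hEY, Finset.sum_mul_sum, dExp_split S]
  refine Finset.sum_congr rfl fun U hU => Finset.sum_congr rfl fun V hV => ?_
  rw [hXU U hU V hV, hYV U hU V hV]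
  ring

variable {α : Fin n → ℝ}

lemma dependsOnRows_HmatD (i j : Fin n) :
    DependsOnRows (fun E => HmatD n α E i j) {i} := by
  intro E
  simp [HmatD, degPlus]

lemma HmatD_nonneg (hα : ∀ i, α i ∈ Set.Icc (0 : ℝ) 1) (E : Finset (Fin n × Fin n))
    (i j : Fin n) : 0 ≤ HmatD n α E i j := by
  have := (hα i).1
  simp only [HmatD, Matrix.of_apply]
  split_ifs <;> positivity

lemma sum_HmatD_row (E : Finset (Fin n × Fin n)) (i : Fin n) :
    ∑ j, HmatD n α E i j = α i := by
  simp only [HmatD, Matrix.of_apply]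
  split_ifs with h
  · simp
  · rw [← Finset.sum_filter, Finset.sum_const, nsmul_eq_mul]
    have hc : (Finset.univ.filter fun j => i ≠ j ∧ (i, j) ∈ E).card = degPlus n E i := by
      simp only [degPlus, ne_comm]
    rw [hc]
    have : (degPlus n E i : ℝ) ≠ 0 := Nat.cast_ne_zero.2 h
    field_simp

lemma pow_nonneg_and_row_sum_le_one {ι : Type*} [Fintype ι] [DecidableEq ι]
    {M : Matrix ι ι ℝ} (h0 : ∀ i j, 0 ≤ M i j) (h1 : ∀ i, ∑ j, M i j ≤ 1) (m : ℕ) :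
    (∀ i j, 0 ≤ (M ^ m) i j) ∧ ∀ i, ∑ j, (M ^ m) i j ≤ 1 := by
  induction m with
  | zero =>
    refine ⟨fun i j => ?_, fun i => ?_⟩
    · rw [pow_zero, Matrix.one_apply]
      split_ifs <;> norm_num
    · simp [Matrix.one_apply]
  | succ m ih =>
    simp only [pow_succ', Matrix.mul_apply]
    refine ⟨fun i j => Finset.sum_nonneg fun l _ => mul_nonneg (h0 i l) (ih.1 l j),
      fun i => ?_⟩
    rw [Finset.sum_comm]
    simp only [← Finset.mul_sum]
    exact (Finset.sum_le_sum fun l _ =>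
      mul_le_of_le_one_right (h0 i l) (ih.2 l)).trans (h1 i)

lemma dExpMat_HmatD_nonneg (hp : p ∈ Set.Ioo (0 : ℝ) 1)
    (hα : ∀ i, α i ∈ Set.Icc (0 : ℝ) 1) (i j : Fin n) :
    0 ≤ dExpMat n p (HmatD n α) i j :=
  dExp_nonneg hp fun E => HmatD_nonneg hα E i j

lemma sum_dExpMat_HmatD_row (i : Fin n) :
    ∑ j, dExpMat n p (HmatD n α) i j = α i := by
  simp only [dExpMat, Matrix.of_apply]
  rw [← dExp_sum]
  simp only [sum_HmatD_row, dExp_const]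

/-- A walk on the random graph agrees in mean with the averaged walk until it
revisits a vertex; `S` is the set of vertices visited so far and `Y` the weight of
the past. -/
lemma sum_abs_dExp_mul_pow_sub_le (hp : p ∈ Set.Ioo (0 : ℝ) 1)
    (hα : ∀ i, α i ∈ Set.Icc (0 : ℝ) 1) {δ : ℝ} (hδ0 : 0 ≤ δ)
    (hδ : ∀ i j, dExpMat n p (HmatD n α) i j ≤ δ) (m : ℕ) :
    ∀ (S : Finset (Fin n)) (i : Fin n) (Y : Finset (Fin n × Fin n) → ℝ),
      i ∉ S → (∀ E, 0 ≤ Y E) → DependsOnRows Y S →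
      ∑ j, |dExp n p (fun E => Y E * (HmatD n α E ^ m) i j) -
          dExp n p Y * (dExpMat n p (HmatD n α) ^ m) i j| ≤
        dExp n p Y * (2 * m * (S.card + m) * δ) := by
  set M := dExpMat n p (HmatD n α)
  have hH (E : Finset (Fin n × Fin n)) (m : ℕ) := pow_nonneg_and_row_sum_le_one
    (HmatD_nonneg hα E) (fun i => (sum_HmatD_row E i).trans_le (hα i).2) m
  have hM0 := dExpMat_HmatD_nonneg hp hα
  have hM1 : ∀ i, ∑ j, M i j ≤ 1 := fun i => (sum_dExpMat_HmatD_row i).trans_le (hα i).2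
  have hMp := pow_nonneg_and_row_sum_le_one hM0 hM1
  induction m with
  | zero =>
    intro S i Y _ _ _
    have h (j : Fin n) : dExp n p (fun E => Y E * (1 : Matrix (Fin n) (Fin n) ℝ) i j) =
        dExp n p Y * (1 : Matrix (Fin n) (Fin n) ℝ) i j := by
      simp only [dExp, Finset.sum_mul, mul_assoc]
    simp [h]
  | succ m ih =>
    intro S i Y hi hY hYS
    have hEY := dExp_nonneg hp hY
    have hZ0 (l : Fin n) (E) : 0 ≤ Y E * HmatD n α E i l :=
      mul_nonneg (hY E) (HmatD_nonneg hα E i l)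
    have hZE (l : Fin n) : dExp n p (fun E => Y E * HmatD n α E i l) =
        dExp n p Y * M i l :=
      dExp_mul_of_disjoint hYS (dependsOnRows_HmatD i l) (by simpa using hi)
    have hZS (l : Fin n) : DependsOnRows (fun E => Y E * HmatD n α E i l) (insert i S) :=
      (hYS.mono (Finset.subset_insert i S)).mul
        ((dependsOnRows_HmatD i l).mono (by simp))
    have hcard : ((insert i S).card : ℝ) = S.card + 1 := by
      rw [Finset.card_insert_of_notMem hi]
      push_cast
      rfl
    have hrow (l : Fin n) :
        ∑ j, |dExp n p (fun E => Y E * HmatD n α E i l * (HmatD n α E ^ m) l j) -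
          dExp n p Y * M i l * (M ^ m) l j| ≤
        dExp n p Y * (M i l * (2 * m * (S.card + 1 + m) * δ) +
          if l ∈ insert i S then 2 * δ else 0) := by
      split_ifs with hl
      · have hs : ∑ j, dExp n p (fun E => Y E * HmatD n α E i l * (HmatD n α E ^ m) l j) ≤
            dExp n p Y * M i l := by
          rw [← dExp_sum, ← hZE]
          refine dExp_mono hp fun E => ?_
          rw [← Finset.mul_sum]
          exact mul_le_of_le_one_right (hZ0 l E) ((hH E m).2 l)
        have ht : ∑ j, dExp n p Y * M i l * (M ^ m) l j ≤ dExp n p Y * M i l := by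
          rw [← Finset.mul_sum]
          exact mul_le_of_le_one_right (mul_nonneg hEY (hM0 i l)) ((hMp m).2 l)
        have hd : dExp n p Y * M i l ≤ dExp n p Y * δ :=
          mul_le_mul_of_nonneg_left (hδ i l) hEY
        have hpos : 0 ≤ dExp n p Y * (M i l * (2 * m * (S.card + 1 + m) * δ)) :=
          mul_nonneg hEY (mul_nonneg (hM0 i l) (by positivity))
        calc _ ≤ ∑ j, (dExp n p (fun E => Y E * HmatD n α E i l * (HmatD n α E ^ m) l j) +
              dExp n p Y * M i l * (M ^ m) l j) := by
              refine Finset.sum_le_sum fun j _ => ?_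
              have ha : 0 ≤ dExp n p
                  (fun E => Y E * HmatD n α E i l * (HmatD n α E ^ m) l j) :=
                dExp_nonneg hp fun E => mul_nonneg (hZ0 l E) ((hH E m).1 l j)
              have hb : 0 ≤ dExp n p Y * M i l * (M ^ m) l j :=
                mul_nonneg (mul_nonneg hEY (hM0 i l)) ((hMp m).1 l j)
              rw [abs_le]
              constructor <;> linarith
          _ ≤ _ := by
              rw [Finset.sum_add_distrib]
              linarith
      · have h := ih (insert i S) l _ hl (hZ0 l) (hZS l)
        rw [hZE, hcard] at h
        rw [add_zero, ← mul_assoc]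
        exact h
    have hexp (j : Fin n) :
        dExp n p (fun E => Y E * (HmatD n α E ^ (m + 1)) i j) -
          dExp n p Y * (M ^ (m + 1)) i j =
        ∑ l, (dExp n p (fun E => Y E * HmatD n α E i l * (HmatD n α E ^ m) l j) -
          dExp n p Y * M i l * (M ^ m) l j) := by
      rw [Finset.sum_sub_distrib, ← dExp_sum]
      simp only [pow_succ', Matrix.mul_apply, Finset.mul_sum, mul_assoc]
    calc _ ≤ ∑ j, ∑ l,
          |dExp n p (fun E => Y E * HmatD n α E i l * (HmatD n α E ^ m) l j) -
            dExp n p Y * M i l * (M ^ m) l j| := by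
          refine Finset.sum_le_sum fun j _ => ?_
          rw [hexp]
          exact Finset.abs_sum_le_sum_abs _ _
      _ ≤ ∑ l, dExp n p Y * (M i l * (2 * m * (S.card + 1 + m) * δ) +
          if l ∈ insert i S then 2 * δ else 0) := by
          rw [Finset.sum_comm]
          exact Finset.sum_le_sum fun l _ => hrow l
      _ = dExp n p Y * ((∑ l, M i l) * (2 * m * (S.card + 1 + m) * δ) +
          (S.card + 1) * (2 * δ)) := by
          rw [← Finset.mul_sum, Finset.sum_add_distrib, ← Finset.sum_mul,
            Finset.sum_ite_mem, Finset.univ_inter, Finset.sum_const, nsmul_eq_mul, hcard]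
      _ ≤ dExp n p Y * (1 * (2 * m * (S.card + 1 + m) * δ) +
          (S.card + 1) * (2 * δ)) := by
          gcongr
          exact hM1 i
      _ ≤ _ := by
          push_cast
          nlinarith [mul_nonneg (mul_nonneg hEY m.cast_nonneg) hδ0]

lemma dExp_map_perm (π : Equiv.Perm (Fin n)) (X : Finset (Fin n × Fin n) → ℝ) :
    dExp n p (fun E => X (E.map (π.prodCongr π).toEmbedding)) = dExp n p X := by
  have key : ∀ (σ : Equiv.Perm (Fin n)), ∀ E ∈ (allDirEdges n).powerset,
      E.map (σ.prodCongr σ).toEmbedding ∈ (allDirEdges n).powerset := by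
    intro σ E hE
    simp only [Finset.mem_powerset] at hE ⊢
    intro e he
    obtain ⟨x, hx, rfl⟩ := Finset.mem_map.1 he
    have := hE hx
    simpa [allDirEdges] using this
  refine Finset.sum_nbij' (fun E => E.map (π.prodCongr π).toEmbedding)
    (fun E => E.map (π.symm.prodCongr π.symm).toEmbedding) (key π) (key π.symm) ?_ ?_ ?_
  · intro E _
    ext ⟨a, b⟩
    simp [Finset.mem_map_equiv]
  · intro E _
    ext ⟨a, b⟩
    simp [Finset.mem_map_equiv]
  · intro E _
    simp [dProb]

lemma dExpMat_HmatD_off_diag_eq {i j l : Fin n} (hj : j ≠ i) (hl : l ≠ i) :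
    dExpMat n p (HmatD n α) i j = dExpMat n p (HmatD n α) i l := by
  simp only [dExpMat, Matrix.of_apply]
  rw [← dExp_map_perm (Equiv.swap j l) (fun E => HmatD n α E i l)]
  refine dExp_congr fun E => ?_
  have hi : Equiv.swap j l i = i := Equiv.swap_apply_of_ne_of_ne hj.symm hl.symm
  have hmem (a : Fin n) : (i, a) ∈ E.map ((Equiv.swap j l).prodCongr
      (Equiv.swap j l)).toEmbedding ↔ (i, Equiv.swap j l a) ∈ E := by
    rw [Finset.mem_map_equiv]
    simp [hi]
  have hdeg : degPlus n (E.map ((Equiv.swap j l).prodCongr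
      (Equiv.swap j l)).toEmbedding) i = degPlus n E i := by
    unfold degPlus
    refine Finset.card_bij' (fun a _ => Equiv.swap j l a) (fun a _ => Equiv.swap j l a)
      ?_ ?_ ?_ ?_
    · intro a ha
      simp only [Finset.mem_filter, Finset.mem_univ, true_and, hmem] at ha ⊢
      refine ⟨fun h => ha.1 ?_, ha.2⟩
      rw [← hi] at h
      exact (Equiv.swap j l).injective h
    · intro a ha
      simp only [Finset.mem_filter, Finset.mem_univ, true_and, hmem,
        Equiv.swap_apply_self] at ha ⊢
      refine ⟨fun h => ha.1 ?_, ha.2⟩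
      rw [← hi] at h
      exact (Equiv.swap j l).injective h
    · simp
    · simp
  simp only [HmatD, Matrix.of_apply, hdeg, hmem, Equiv.swap_apply_right]
  simp [hj.symm, hl.symm]

lemma dExpMat_HmatD_off_diag_le (hp : p ∈ Set.Ioo (0 : ℝ) 1)
    (hα : ∀ i, α i ∈ Set.Icc (0 : ℝ) 1) {i j : Fin n} (hj : j ≠ i) :
    ((n : ℝ) - 1) * dExpMat n p (HmatD n α) i j ≤ 1 := by
  have hn : 1 ≤ n := i.pos
  have h : ∑ l ∈ Finset.univ.erase i, dExpMat n p (HmatD n α) i l =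
      ((n : ℝ) - 1) * dExpMat n p (HmatD n α) i j := by
    rw [Finset.sum_congr rfl fun l hl =>
      dExpMat_HmatD_off_diag_eq (Finset.ne_of_mem_erase hl) hj]
    simp [Nat.cast_sub hn]
  rw [← h]
  calc _ ≤ ∑ l, dExpMat n p (HmatD n α) i l :=
        Finset.sum_le_sum_of_subset_of_nonneg (Finset.erase_subset _ _)
          fun l _ _ => dExpMat_HmatD_nonneg hp hα i l
    _ ≤ 1 := (sum_dExpMat_HmatD_row i).trans_le (hα i).2

lemma card_allDirEdges_row (i : Fin n) :
    ((allDirEdges n).filter fun e => e.1 ∈ ({i} : Finset (Fin n))).card = n - 1 := by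
  have h : ((allDirEdges n).filter fun e => e.1 ∈ ({i} : Finset (Fin n))) =
      (Finset.univ.erase i).map (Function.Embedding.sectR i (Fin n)) := by
    ext ⟨a, b⟩
    simp only [allDirEdges, Finset.mem_filter, Finset.mem_univ, true_and,
      Finset.mem_singleton, Finset.mem_map, Finset.mem_erase,
      Function.Embedding.sectR_apply, Prod.mk.injEq]
    constructor
    · rintro ⟨h, rfl⟩
      exact ⟨b, ⟨Ne.symm h, trivial⟩, rfl, rfl⟩
    · rintro ⟨c, ⟨hc, -⟩, rfl, rfl⟩
      exact ⟨hc.symm, rfl⟩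
  rw [h]
  simp

lemma dExpMat_HmatD_diag (i : Fin n) :
    dExpMat n p (HmatD n α) i i = (1 - p) ^ (n - 1) * α i := by
  simp only [dExpMat, Matrix.of_apply]
  rw [dExp_split {i}]
  set A := (allDirEdges n).filter fun e => e.1 ∈ ({i} : Finset (Fin n)) with hA
  set B := (allDirEdges n).filter fun e => e.1 ∉ ({i} : Finset (Fin n)) with hB
  have hval : ∀ U ∈ A.powerset, ∀ V ∈ B.powerset,
      HmatD n α (U ∪ V) i i = if U = ∅ then α i else 0 := by
    intro U hU V hV
    rw [Finset.mem_powerset] at hU hV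
    have hdeg : degPlus n (U ∪ V) i = 0 ↔ U = ∅ := by
      rw [degPlus, Finset.card_eq_zero, Finset.filter_eq_empty_iff,
        Finset.eq_empty_iff_forall_notMem]
      constructor
      · rintro h ⟨a, b⟩ hab
        have h1 := hU hab
        simp only [hA, allDirEdges, Finset.mem_filter, Finset.mem_univ, true_and,
          Finset.mem_singleton] at h1
        obtain ⟨h1, rfl⟩ := h1
        exact h (Finset.mem_univ b) ⟨Ne.symm h1, Finset.mem_union_left _ hab⟩
      · rintro h b - ⟨-, hb⟩
        rcases Finset.mem_union.1 hb with hb | hb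
        · exact h _ hb
        · have := hV hb
          simp [hB] at this
    simp only [HmatD, Matrix.of_apply, hdeg]
    simp
  calc _ = ∑ U ∈ A.powerset, subsetWeight p A U * (if U = ∅ then α i else 0) := by
        refine Finset.sum_congr rfl fun U hU => ?_
        calc _ = ∑ V ∈ B.powerset, subsetWeight p B V *
              (subsetWeight p A U * (if U = ∅ then α i else 0)) :=
              Finset.sum_congr rfl fun V hV => by rw [hval U hU V hV]; ring
          _ = _ := by rw [← Finset.sum_mul, sum_subsetWeight, one_mul]
    _ = subsetWeight p A ∅ * α i := by simp
    _ = _ := by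
        rw [subsetWeight, hA, card_allDirEdges_row]
        simp

lemma one_sub_pow_le_inv {n : ℕ} (hn : 2 ≤ n) {p : ℝ} (hp : p ∈ Set.Ioo (0 : ℝ) 1)
    (h : 2 ≤ p / (Real.log n / n)) : (1 - p) ^ (n - 1) ≤ 1 / n := by
  have hn' : (2 : ℝ) ≤ n := by exact_mod_cast hn
  have hlog : 0 < Real.log n := Real.log_pos (by linarith)
  have hpn : 2 * Real.log n ≤ p * n := by
    rw [le_div_iff₀ (by positivity)] at h
    calc 2 * Real.log n = 2 * (Real.log n / n) * n := by field_simp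
      _ ≤ p * n := by gcongr
  have hle : Real.log n ≤ ((n - 1 : ℕ) : ℝ) * p := by
    rw [Nat.cast_sub (by omega), Nat.cast_one]
    nlinarith [hp.1]
  calc (1 - p) ^ (n - 1) ≤ Real.exp (-p) ^ (n - 1) :=
        pow_le_pow_left₀ (by linarith [hp.2]) (Real.one_sub_le_exp_neg p) _
    _ = Real.exp (-(((n - 1 : ℕ) : ℝ) * p)) := by rw [← Real.exp_nat_mul, mul_neg]
    _ ≤ Real.exp (-Real.log n) := Real.exp_le_exp.2 (by linarith)
    _ = 1 / n := by rw [Real.exp_neg, Real.exp_log (by linarith), one_div]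

lemma dExpMat_HmatD_le (hn : 2 ≤ n) (hp : p ∈ Set.Ioo (0 : ℝ) 1)
    (hα : ∀ i, α i ∈ Set.Icc (0 : ℝ) 1) (h : 2 ≤ p / (Real.log n / n)) (i j : Fin n) :
    dExpMat n p (HmatD n α) i j ≤ 2 / n := by
  have hn' : (2 : ℝ) ≤ n := by exact_mod_cast hn
  by_cases hj : j = i
  · subst hj
    rw [dExpMat_HmatD_diag]
    calc _ ≤ (1 - p) ^ (n - 1) :=
          mul_le_of_le_one_right (pow_nonneg (by linarith [hp.2]) _) (hα j).2
      _ ≤ 1 / n := one_sub_pow_le_inv hn hp h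
      _ ≤ 2 / n := by gcongr; norm_num
  · have h1 := dExpMat_HmatD_off_diag_le hp hα hj
    have h0 := dExpMat_HmatD_nonneg hp hα i j
    rw [le_div_iff₀ (by linarith)]
    nlinarith

lemma starNorm_dExpMat_pow_sub_le (hn : 2 ≤ n) (hp : p ∈ Set.Ioo (0 : ℝ) 1)
    (hα : ∀ i, α i ∈ Set.Icc (0 : ℝ) 1) (h : 2 ≤ p / (Real.log n / n)) (k : ℕ) :
    starNorm (dExpMat n p (fun E => HmatD n α E ^ k) - dExpMat n p (HmatD n α) ^ k) ≤
      4 * k ^ 2 / n := by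
  have : Nonempty (Fin n) := ⟨⟨0, by omega⟩⟩
  refine ciSup_le fun i => ?_
  have hb := sum_abs_dExp_mul_pow_sub_le hp hα (by positivity)
    (dExpMat_HmatD_le hn hp hα h) k ∅ i (fun _ => 1) (by simp) (fun _ => zero_le_one)
    (fun _ => rfl)
  simp only [dExp_const, one_mul, Finset.card_empty, Nat.cast_zero, zero_add] at hb
  refine hb.trans_eq ?_
  ring

end DirectedErdosRenyi

/-- **Proposition (mean-field approximation of matrix powers, directed model).**
Let `G ∼ D(n,p)` with condescendence parameters `α n i ∈ [0,1]` and suppose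
`p ≫ log n / n`.  Then for every fixed `k ∈ ℕ` there is a constant `C(k) > 0`
such that for all sufficiently large `n`,
`‖E(H(G)^k) − E(H(G))^k‖_* ≤ C(k)/n`, which tends to `0` as `n → ∞`. -/
theorem difference_for_fixed_exponent_directed
    (p : ℕ → ℝ) (hp : ∀ n, p n ∈ Set.Ioo (0 : ℝ) 1)
    (α : (n : ℕ) → Fin n → ℝ) (hα : ∀ n i, α n i ∈ Set.Icc (0 : ℝ) 1)
    (hreg : Tendsto (fun n : ℕ => p n / (Real.log n / n)) atTop atTop)
    (k : ℕ) :
    ∃ C : ℝ, 0 < C ∧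
      (∀ᶠ n : ℕ in atTop,
        starNorm (dExpMat n (p n) (fun E => HmatD n (α n) E ^ k) -
            dExpMat n (p n) (HmatD n (α n)) ^ k) ≤ C / (n : ℝ)) ∧
      Tendsto
        (fun n : ℕ =>
          starNorm (dExpMat n (p n) (fun E => HmatD n (α n) E ^ k) -
            dExpMat n (p n) (HmatD n (α n)) ^ k))
        atTop (nhds 0) := by
  have hev : ∀ᶠ n : ℕ in atTop,
      starNorm (dExpMat n (p n) (fun E => HmatD n (α n) E ^ k) -
        dExpMat n (p n) (HmatD n (α n)) ^ k) ≤ (4 * k ^ 2 + 1 : ℝ) / (n : ℝ) := by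
    filter_upwards [hreg.eventually_ge_atTop 2, eventually_ge_atTop 2] with n h hn
    refine (starNorm_dExpMat_pow_sub_le hn (hp n) (hα n) h k).trans ?_
    gcongr
    linarith
  refine ⟨4 * k ^ 2 + 1, by positivity, hev, ?_⟩
  refine tendsto_of_tendsto_of_tendsto_of_le_of_le' tendsto_const_nhds
    (tendsto_const_div_atTop_nhds_zero_nat (4 * k ^ 2 + 1 : ℝ)) ?_ hev
  exact Eventually.of_forall fun n =>
    Real.iSup_nonneg fun i => Finset.sum_nonneg fun j _ => abs_nonneg _
end
end
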